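/- For every Barański sponge Λ_Φ, the dynamical dimension equals the supremum of the Hausdorff dimensions of its Bernoulli measures: DynD(Φ) = sup_{p∈P} HD(ν_p). -/

import Mathlib

open MeasureTheory Filter Set Metric
open scoped Classical Topology ENNReal NNReal

namespace SelfAffineSponge

/-- A diagonal IFS on `[0,1]^d`: for each coordinate `i ∈ D = Fin d` a finite alphabet
`A i` indexing affine maps `x ↦ slope i a * x + off i a` of `[0,1]`, together with a
set `E ⊆ ∏ i, A i` of allowed tuples of symbols. -/
structure DiagIFS (d : ℕ) (A : Fin d → Type) [∀ i, Fintype (A i)] where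
  slope : ∀ i : Fin d, A i → ℝ
  off : ∀ i : Fin d, A i → ℝ
  E : Finset (∀ i, A i)

variable {d : ℕ} {A : Fin d → Type} [∀ i, Fintype (A i)]

namespace DiagIFS

/-- the base similarity `φ_{i,a}` in coordinate `i` -/
def base (Φ : DiagIFS d A) (i : Fin d) (a : A i) (x : ℝ) : ℝ :=
  Φ.slope i a * x + Φ.off i a

/-- the data defines an honest diagonal IFS: `E` is nonempty and each base map is a
contracting similarity of `[0,1]` -/
def Valid (Φ : DiagIFS d A) : Prop :=
  Φ.E.Nonempty ∧ (∀ i a, Φ.slope i a ≠ 0) ∧ (∀ i a, |Φ.slope i a| < 1) ∧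
    ∀ i a, ∀ x ∈ Set.Icc (0:ℝ) 1, Φ.base i a x ∈ Set.Icc (0:ℝ) 1

/-- the alphabet `E` of the IFS, as a type -/
abbrev Symb (Φ : DiagIFS d A) : Type _ := {a : ∀ i, A i // a ∈ Φ.E}

instance (Φ : DiagIFS d A) : MeasurableSpace Φ.Symb := ⊤
instance (Φ : DiagIFS d A) : TopologicalSpace Φ.Symb := ⊥

/-- the affine contraction `φ_a` of `[0,1]^d` associated to a tuple of symbols -/
def affMap (Φ : DiagIFS d A) (a : ∀ i, A i) (x : Fin d → ℝ) : Fin d → ℝ :=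
  fun i => Φ.base i (a i) (x i)

/-- the coding map `π(ω) = lim_n φ_{ω_0}∘⋯∘φ_{ω_{n-1}}(0)`, written in closed form -/
noncomputable def coding (Φ : DiagIFS d A) (ω : ℕ → Φ.Symb) : Fin d → ℝ :=
  fun i => ∑' n : ℕ, (∏ k ∈ Finset.range n, Φ.slope i ((ω k).1 i)) * Φ.off i ((ω n).1 i)

/-- the limit set `Λ_Φ = π(E^ℕ)` (the self-affine sponge) -/
def limitSet (Φ : DiagIFS d A) : Set (Fin d → ℝ) :=
  Set.range Φ.coding

theorem coding_mem (Φ : DiagIFS d A) (ω : ℕ → Φ.Symb) : Φ.coding ω ∈ Φ.limitSet :=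
  ⟨ω, rfl⟩

/-- the `i`-th Lyapunov exponent `χ_i(p) = -∫ log|φ'_{a,i}| dp(a)` of a finite measure
`p` on `E` (given by its density) -/
noncomputable def chi (Φ : DiagIFS d A) (i : Fin d) (p : Φ.Symb → ℝ) : ℝ :=
  -∑ a : Φ.Symb, p a * Real.log |Φ.slope i (a.1 i)|

/-- the mass `p([a]_I)` of the cylinder `[a]_I = {b ∈ E : b_i = a_i ∀ i ∈ I}` -/
noncomputable def cylMass (Φ : DiagIFS d A) (I : Finset (Fin d)) (p : Φ.Symb → ℝ)
    (a : Φ.Symb) : ℝ :=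
  ∑ b : Φ.Symb, if ∀ i ∈ I, b.1 i = a.1 i then p b else 0

/-- the entropy `h(I; p) = -∫ log p([a]_I) dp(a)` -/
noncomputable def entropy (Φ : DiagIFS d A) (I : Finset (Fin d)) (p : Φ.Symb → ℝ) : ℝ :=
  -∑ a : Φ.Symb, p a * Real.log (Φ.cylMass I p a)

/-- the conditional entropy `h(I' | I; p) = h(I';p) - h(I;p)` -/
noncomputable def condEntropy (Φ : DiagIFS d A) (I I' : Finset (Fin d))
    (p : Φ.Symb → ℝ) : ℝ :=
  Φ.entropy I' p - Φ.entropy I p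

/-- a coordinate set `I ⊆ D` is good if the projected IFS `Φ_I` satisfies the open set
condition: the boxes `φ_{I,a}((0,1)^I)`, indexed by distinct projections of elements of
`E`, are pairwise disjoint (equivalently, some coordinate has disjoint intervals). -/
def GoodIdx (Φ : DiagIFS d A) (I : Finset (Fin d)) : Prop :=
  ∀ a ∈ Φ.E, ∀ b ∈ Φ.E, (∃ i ∈ I, a i ≠ b i) →
    ∃ i ∈ I, Disjoint (Φ.base i (a i) '' Set.Ioo (0:ℝ) 1)
      (Φ.base i (b i) '' Set.Ioo (0:ℝ) 1)

/-- Barański condition: each base IFS satisfies the open set condition w.r.t. `(0,1)` -/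
def Baranski (Φ : DiagIFS d A) : Prop :=
  ∀ i : Fin d, ∀ a b : A i, a ≠ b →
    Disjoint (Φ.base i a '' Set.Ioo (0:ℝ) 1) (Φ.base i b '' Set.Ioo (0:ℝ) 1)

/-- strong Barański condition: each base IFS satisfies the strong separation condition
w.r.t. `[0,1]` -/
def StronglyBaranski (Φ : DiagIFS d A) : Prop :=
  ∀ i : Fin d, ∀ a b : A i, a ≠ b →
    Disjoint (Φ.base i a '' Set.Icc (0:ℝ) 1) (Φ.base i b '' Set.Icc (0:ℝ) 1)

/-- coordinate ordering condition: some permutation `σ` of the coordinates has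
`|φ'_{a,σ(1)}| > ⋯ > |φ'_{a,σ(d)}|` for all `a ∈ E` -/
def CoordOrdering (Φ : DiagIFS d A) : Prop :=
  ∃ σ : Equiv.Perm (Fin d), ∀ a ∈ Φ.E, ∀ i j : Fin d, i < j →
    |Φ.slope (σ j) (a (σ j))| < |Φ.slope (σ i) (a (σ i))|

end DiagIFS

/-- a probability vector (probability measure on a finite set, via its density) -/
def IsProbVec {α : Type*} [Fintype α] (p : α → ℝ) : Prop :=
  (∀ a, 0 ≤ p a) ∧ ∑ a, p a = 1

/-- a measure `p` on `E` is good if `I(p,x) = {i : χ_i(p) ≤ x}` is good for all `x > 0` -/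
def DiagIFS.GoodVec (Φ : DiagIFS d A) (p : Φ.Symb → ℝ) : Prop :=
  ∀ x > 0, Φ.GoodIdx (Finset.univ.filter fun i => Φ.chi i p ≤ x)

/-- a cycle on `E`: a continuous exponentially `λ`-periodic map `(0,∞) → P`,
where `λ = 1` means constant -/
structure Cycle (Φ : DiagIFS d A) where
  lam : ℝ
  one_le_lam : 1 ≤ lam
  r : ℝ → Φ.Symb → ℝ
  prob : ∀ b > 0, IsProbVec (r b)
  cont : ContinuousOn r (Set.Ioi 0)
  periodic : ∀ b > 0, r (lam * b) = r b
  const_of_lam_eq_one : lam = 1 → ∀ b > 0, ∀ b' > 0, r b = r b'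

/-- the number `B_i`, determined by `B = ∫_0^{B_i} χ_i(r_b) db` (written via `sInf`;
for a cycle the function `x ↦ ∫_0^x χ_i(r_b) db` is continuous and strictly
increasing, so the infimum is the unique solution) -/
noncomputable def Bcoord (Φ : DiagIFS d A) (r : ℝ → Φ.Symb → ℝ) (B : ℝ) (i : Fin d) : ℝ :=
  sInf {x : ℝ | 0 ≤ x ∧ B ≤ ∫ b in Set.Ioc (0:ℝ) x, Φ.chi i (r b)}

/-- `δ(r, B) = B⁻¹ ∫_0^∞ h({i : b ≤ B_i}; r_b) db` -/
noncomputable def deltaRB (Φ : DiagIFS d A) (r : ℝ → Φ.Symb → ℝ) (B : ℝ) : ℝ :=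
  B⁻¹ * ∫ b in Set.Ioi (0:ℝ),
    Φ.entropy (Finset.univ.filter fun i => b ≤ Bcoord Φ r B i) (r b)

/-- `δ(r) = inf_{B ∈ [1,λ]} δ(r,B)` -/
noncomputable def Cycle.delta {Φ : DiagIFS d A} (c : Cycle Φ) : ℝ :=
  sInf (deltaRB Φ c.r '' Set.Icc 1 c.lam)

/-- `δ(p) = ∫_0^∞ h({i : b ≤ 1/χ_i(p)}; p) db` -/
noncomputable def deltaP (Φ : DiagIFS d A) (p : Φ.Symb → ℝ) : ℝ :=
  ∫ b in Set.Ioi (0:ℝ),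
    Φ.entropy (Finset.univ.filter fun i => b ≤ (Φ.chi i p)⁻¹) p

/-- the normalized average `R̂_B = B⁻¹ ∫_0^B r_b db` of a cycle -/
noncomputable def cycleAvg {Φ : DiagIFS d A} (c : Cycle Φ) (B : ℝ) : Φ.Symb → ℝ :=
  fun a => B⁻¹ * ∫ b in Set.Ioc (0:ℝ) B, c.r b a

/-- a cycle is good if all its normalized averages `R̂_B` are good -/
def Cycle.Good {Φ : DiagIFS d A} (c : Cycle Φ) : Prop :=
  ∀ B > 0, Φ.GoodVec (cycleAvg c B)

/-- a cycle is nondegenerate if `{b > 0 : r_b(a) > 0 ∀ a ∈ E_r}` is dense in `(0,∞)` -/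
def Cycle.Nondeg {Φ : DiagIFS d A} (c : Cycle Φ) : Prop :=
  Set.Ioi (0:ℝ) ⊆
    closure {b : ℝ | 0 < b ∧ ∀ a : Φ.Symb, (∃ b' > 0, 0 < c.r b' a) → 0 < c.r b a}

/-- the lower pointwise dimension `d̲(x,μ) = liminf_{ρ→0} log μ(B(x,ρ))/log ρ` -/
noncomputable def lowerPtDim {X : Type*} [PseudoMetricSpace X] [MeasurableSpace X]
    (μ : Measure X) (x : X) : ℝ≥0∞ :=
  Filter.liminf
    (fun ρ : ℝ => ENNReal.ofReal (Real.log (μ (Metric.ball x ρ)).toReal / Real.log ρ))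
    (𝓝[>] (0:ℝ))

/-- the Hausdorff dimension of a measure: the essential supremum of its lower
pointwise dimension -/
noncomputable def measDim {X : Type*} [PseudoMetricSpace X] [MeasurableSpace X]
    (μ : Measure X) : ℝ≥0∞ :=
  essSup (lowerPtDim μ) μ

/-- the shift map on `E^ℕ` -/
def shift {α : Type*} (ω : ℕ → α) : ℕ → α := fun n => ω (n + 1)

/-- the dynamical dimension: the supremum of `HD(π_*μ)` over shift-invariant
probability measures `μ` on `E^ℕ` -/
noncomputable def DiagIFS.dynDim (Φ : DiagIFS d A) : ℝ≥0∞ :=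
  sSup {x : ℝ≥0∞ | ∃ μ : Measure (ℕ → Φ.Symb), IsProbabilityMeasure μ ∧
    Measure.map shift μ = μ ∧ x = measDim (Measure.map Φ.coding μ)}

/-- `μ` is the product measure on `E^ℕ` whose `k`-th factor has density `p k`
(this property characterizes `μ` uniquely) -/
def IsProductMeasure (Φ : DiagIFS d A) (p : ℕ → Φ.Symb → ℝ)
    (μ : Measure (ℕ → Φ.Symb)) : Prop :=
  IsProbabilityMeasure μ ∧
    ∀ (n : ℕ) (w : ℕ → Φ.Symb),
      (μ {ω | ∀ k < n, ω k = w k}).toReal = ∏ k ∈ Finset.range n, p k (w k)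

/-- the set of Hausdorff dimensions of Bernoulli measures `ν_p = π_*[p^ℕ]` -/
noncomputable def bernoulliDims (Φ : DiagIFS d A) : Set ℝ≥0∞ :=
  {x | ∃ p : Φ.Symb → ℝ, IsProbVec p ∧ ∃ μ : Measure (ℕ → Φ.Symb),
    IsProductMeasure Φ (fun _ => p) μ ∧ x = measDim (Measure.map Φ.coding μ)}

/-- the set of Hausdorff dimensions of pseudo-Bernoulli measures
`ν_r = π_*[∏_n r_n]` -/
noncomputable def pseudoBernoulliDims (Φ : DiagIFS d A) : Set ℝ≥0∞ :=
  {x | ∃ c : Cycle Φ, ∃ μ : Measure (ℕ → Φ.Symb),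
    IsProductMeasure Φ (fun n => c.r ((n : ℝ) + 1)) μ ∧
      x = measDim (Measure.map Φ.coding μ)}

section Birkhoff

variable {Ω : Type*} {T : Ω → Ω} {f : Ω → ℝ}

theorem birkhoffSum_nonneg (h0 : ∀ ω, 0 ≤ f ω) (n : ℕ) (ω : Ω) : 0 ≤ birkhoffSum T f n ω :=
  Finset.sum_nonneg fun _ _ => h0 _

theorem birkhoffAverage_mem_Icc (h0 : ∀ ω, 0 ≤ f ω) (h1 : ∀ ω, f ω ≤ 1) (n : ℕ) (ω : Ω) :
    birkhoffAverage ℝ T f n ω ∈ Icc (0 : ℝ) 1 := by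
  have hle : birkhoffSum T f n ω ≤ n := by
    calc birkhoffSum T f n ω ≤ ∑ _k ∈ Finset.range n, (1 : ℝ) := Finset.sum_le_sum fun _ _ => h1 _
      _ = n := by simp
  simp only [birkhoffAverage, smul_eq_mul]
  constructor
  · exact mul_nonneg (by positivity) (birkhoffSum_nonneg h0 n ω)
  · rcases Nat.eq_zero_or_pos n with rfl | hn
    · simp
    · have : (0 : ℝ) < n := by exact_mod_cast hn
      rw [inv_mul_le_iff₀ this]; linarith

/-- the upper limit of the Birkhoff averages -/
noncomputable def birkhoffLimsup (T : Ω → Ω) (f : Ω → ℝ) (ω : Ω) : ℝ :=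
  limsup (fun n => birkhoffAverage ℝ T f n ω) atTop

theorem isBoundedUnder_birkhoffAverage (h0 : ∀ ω, 0 ≤ f ω) (h1 : ∀ ω, f ω ≤ 1) (ω : Ω) :
    IsBoundedUnder (· ≤ ·) atTop (fun n => birkhoffAverage ℝ T f n ω) :=
  isBoundedUnder_of ⟨1, fun n => (birkhoffAverage_mem_Icc h0 h1 n ω).2⟩

theorem isCoboundedUnder_birkhoffAverage (h0 : ∀ ω, 0 ≤ f ω) (h1 : ∀ ω, f ω ≤ 1) (ω : Ω) :
    IsCoboundedUnder (· ≤ ·) atTop (fun n => birkhoffAverage ℝ T f n ω) :=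
  IsBoundedUnder.isCoboundedUnder_le
    (isBoundedUnder_of ⟨0, fun n => (birkhoffAverage_mem_Icc h0 h1 n ω).1⟩)

theorem birkhoffLimsup_le_one (h0 : ∀ ω, 0 ≤ f ω) (h1 : ∀ ω, f ω ≤ 1) (ω : Ω) :
    birkhoffLimsup T f ω ≤ 1 :=
  limsup_le_of_le (isCoboundedUnder_birkhoffAverage h0 h1 ω)
    (Eventually.of_forall fun n => (birkhoffAverage_mem_Icc h0 h1 n ω).2)

theorem birkhoffLimsup_nonneg (h0 : ∀ ω, 0 ≤ f ω) (h1 : ∀ ω, f ω ≤ 1) (ω : Ω) :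
    0 ≤ birkhoffLimsup T f ω :=
  le_limsup_of_le (isBoundedUnder_birkhoffAverage h0 h1 ω) fun _ hb =>
    let ⟨n, hn⟩ := hb.exists
    (birkhoffAverage_mem_Icc h0 h1 n ω).1.trans hn

theorem birkhoffLimsup_apply (h0 : ∀ ω, 0 ≤ f ω) (h1 : ∀ ω, f ω ≤ 1) (ω : Ω) :
    birkhoffLimsup T f (T ω) = birkhoffLimsup T f ω := by
  have hb : Bornology.IsBounded (range fun n => f (T^[n] ω)) := by
    refine (Metric.isBounded_Icc (0 : ℝ) 1).subset ?_
    rintro _ ⟨n, rfl⟩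
    exact ⟨h0 _, h1 _⟩
  have ht := tendsto_birkhoffAverage_apply_sub_birkhoffAverage ℝ hb
  apply le_antisymm
  · refine le_of_forall_pos_le_add fun ε hε => ?_
    refine limsup_le_of_le (isCoboundedUnder_birkhoffAverage h0 h1 _) ?_
    have h2 := eventually_lt_of_limsup_lt (show birkhoffLimsup T f ω < birkhoffLimsup T f ω + ε / 2
      by linarith) (isBoundedUnder_birkhoffAverage h0 h1 ω)
    filter_upwards [h2, ht.eventually (gt_mem_nhds (half_pos hε))] with n hn hn'
    linarith
  · refine le_of_forall_pos_le_add fun ε hε => ?_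
    refine limsup_le_of_le (isCoboundedUnder_birkhoffAverage h0 h1 _) ?_
    have h2 := eventually_lt_of_limsup_lt (show birkhoffLimsup T f (T ω) <
      birkhoffLimsup T f (T ω) + ε / 2 by linarith) (isBoundedUnder_birkhoffAverage h0 h1 (T ω))
    filter_upwards [h2, ht.eventually (lt_mem_nhds (neg_neg_of_pos (half_pos hε)))] with n hn hn'
    linarith

/-- Greedy decomposition of an orbit into blocks on which the Birkhoff average is large. -/
theorem mul_sub_le_birkhoffSum {g G : Ω → ℝ} {M : ℕ} (hg : ∀ ω, 0 ≤ g ω)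
    (hG : ∀ ω, G ω ≤ 1) (hGT : ∀ ω, G (T ω) = G ω)
    (hblock : ∀ ω, ∃ n, 1 ≤ n ∧ n ≤ M ∧ n * G ω ≤ birkhoffSum T g n ω) (L : ℕ) (ω : Ω) :
    L * G ω - M ≤ birkhoffSum T g L ω := by
  have hGn : ∀ n ω, G (T^[n] ω) = G ω := by
    intro n
    induction n with
    | zero => intro ω; rfl
    | succ n ih => intro ω; rw [Function.iterate_succ_apply, ih, hGT]
  induction L using Nat.strong_induction_on generalizing ω with
  | _ L ih =>
    by_cases hL : L ≤ M
    · have h1 : (L : ℝ) * G ω ≤ L * 1 := by gcongr; exact hG ω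
      have h2 : (L : ℝ) ≤ M := by exact_mod_cast hL
      linarith [birkhoffSum_nonneg (T := T) hg L ω]
    · obtain ⟨n, hn1, hnM, hn⟩ := hblock ω
      obtain ⟨k, rfl⟩ : ∃ k, L = n + k := ⟨L - n, by omega⟩
      have := ih k (by omega) (T^[n] ω)
      rw [hGn] at this
      rw [birkhoffSum_add]
      push_cast
      linarith

variable [MeasurableSpace Ω] {μ : Measure Ω}

theorem measurable_birkhoffAverage (hT : Measurable T) (hf : Measurable f) (n : ℕ) :
    Measurable (birkhoffAverage ℝ T f n) := by
  unfold birkhoffAverage birkhoffSum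
  have := fun k => hf.comp (hT.iterate k)
  simp only [Function.comp_def] at this
  fun_prop

theorem measurable_birkhoffLimsup (hT : Measurable T) (hf : Measurable f) :
    Measurable (birkhoffLimsup T f) :=
  Measurable.limsup fun n => measurable_birkhoffAverage hT hf n

theorem integral_birkhoffSum (hT : MeasurePreserving T μ μ) (hfm : Measurable f)
    (hf : Integrable f μ) (n : ℕ) :
    Integrable (birkhoffSum T f n) μ ∧ ∫ ω, birkhoffSum T f n ω ∂μ = n * ∫ ω, f ω ∂μ := by
  have hi : ∀ k, Integrable (fun ω => f (T^[k] ω)) μ := fun k =>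
    (hT.iterate k).integrable_comp_of_integrable hf
  refine ⟨integrable_finsetSum _ fun k _ => hi k, ?_⟩
  unfold birkhoffSum
  rw [integral_finsetSum _ fun k _ => hi k]
  have : ∀ k, ∫ ω, f (T^[k] ω) ∂μ = ∫ ω, f ω ∂μ := fun k => by
    conv_rhs => rw [← (hT.iterate k).map_eq]
    rw [integral_map (hT.iterate k).measurable.aemeasurable hfm.aestronglyMeasurable]
  simp [this]

theorem integrable_of_mem_Icc [IsFiniteMeasure μ] {g : Ω → ℝ} (hg : Measurable g)
    (h0 : ∀ ω, 0 ≤ g ω) (h1 : ∀ ω, g ω ≤ 1) : Integrable g μ :=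
  Integrable.of_bound hg.aestronglyMeasurable 1
    (Eventually.of_forall fun ω => by rw [Real.norm_of_nonneg (h0 ω)]; exact h1 ω)

theorem integral_birkhoffLimsup_le [IsProbabilityMeasure μ] (hT : MeasurePreserving T μ μ)
    (hf : Measurable f) (h0 : ∀ ω, 0 ≤ f ω) (h1 : ∀ ω, f ω ≤ 1) :
    ∫ ω, birkhoffLimsup T f ω ∂μ ≤ ∫ ω, f ω ∂μ := by
  refine le_of_forall_pos_le_add fun ε hε => ?_
  set F := birkhoffLimsup T f with hF
  have hFm : Measurable F := measurable_birkhoffLimsup hT.measurable hf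
  have hFi : Integrable F μ := integrable_of_mem_Icc hFm (birkhoffLimsup_nonneg h0 h1)
    (birkhoffLimsup_le_one h0 h1)
  have hfi : Integrable f μ := integrable_of_mem_Icc hf h0 h1
  set bad : ℕ → Set Ω := fun M => {ω | ∀ n, 1 ≤ n → n ≤ M →
    birkhoffAverage ℝ T f n ω ≤ F ω - ε / 2} with hbad
  have hbadm : ∀ M, MeasurableSet (bad M) := fun M => by
    simp only [hbad, ofPred_forall]
    exact MeasurableSet.iInter fun n => MeasurableSet.iInter fun _ => MeasurableSet.iInter fun _ =>
      measurableSet_le (measurable_birkhoffAverage hT.measurable hf n) (hFm.sub_const _)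
  have hanti : Antitone bad := fun M N hMN ω hω n hn hnM => hω n hn (hnM.trans hMN)
  have hempty : ⋂ M, bad M = ∅ := by
    refine eq_empty_of_forall_notMem fun ω hω => ?_
    rw [mem_iInter] at hω
    have hfr := frequently_lt_of_lt_limsup (isCoboundedUnder_birkhoffAverage h0 h1 ω)
      (show F ω - ε / 2 < birkhoffLimsup T f ω by rw [← hF]; linarith)
    obtain ⟨n, hn, hn1⟩ := (hfr.and_eventually (eventually_ge_atTop 1)).exists
    exact absurd (hω n n hn1 le_rfl) (not_le.2 hn)
  have htend := tendsto_measure_iInter_atTop (μ := μ) (fun M => (hbadm M).nullMeasurableSet) hanti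
    ⟨0, measure_ne_top _ _⟩
  rw [hempty, measure_empty] at htend
  obtain ⟨M, hM, hM1⟩ := ((htend.eventually (gt_mem_nhds (ENNReal.ofReal_pos.2
    (half_pos hε)))).and (eventually_ge_atTop 1)).exists
  have hM' : μ.real (bad M) ≤ ε / 2 := by
    rw [Measure.real]
    exact ENNReal.toReal_le_of_le_ofReal (by positivity) hM.le
  set g : Ω → ℝ := fun ω => f ω + (bad M).indicator (fun _ => (1 : ℝ)) ω with hg
  have hind : ∀ ω, 0 ≤ (bad M).indicator (fun _ => (1 : ℝ)) ω := fun ω =>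
    indicator_nonneg (fun _ _ => zero_le_one) ω
  have hindm : Measurable ((bad M).indicator (fun _ => (1 : ℝ))) :=
    measurable_const.indicator (hbadm M)
  have hindi : Integrable ((bad M).indicator (fun _ => (1 : ℝ))) μ :=
    (integrable_const _).indicator (hbadm M)
  have hgi : Integrable g μ := hfi.add hindi
  have hgint : ∫ ω, g ω ∂μ ≤ ∫ ω, f ω ∂μ + ε / 2 := by
    rw [hg, integral_add hfi hindi, integral_indicator (hbadm M)]
    simpa using hM'
  have hmain := mul_sub_le_birkhoffSum (T := T) (g := g) (G := fun ω => F ω - ε / 2) (M := M)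
    (fun ω => add_nonneg (h0 ω) (hind ω))
    (fun ω => by linarith [birkhoffLimsup_le_one (T := T) h0 h1 ω])
    (fun ω => by simp only [hF, birkhoffLimsup_apply h0 h1]) (fun ω => by
      by_cases hω : ω ∈ bad M
      · refine ⟨1, le_rfl, hM1, ?_⟩
        simp only [birkhoffSum_one, hg, indicator_of_mem hω]
        push_cast
        linarith [birkhoffLimsup_le_one (T := T) h0 h1 ω, h0 ω]
      · simp only [hbad, mem_ofPred_eq, not_forall, not_le] at hω
        obtain ⟨n, hn1, hnM, hn⟩ := hω
        refine ⟨n, hn1, hnM, ?_⟩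
        have hn0 : (0 : ℝ) < n := by exact_mod_cast hn1
        have : birkhoffSum T f n ω ≤ birkhoffSum T g n ω :=
          Finset.sum_le_sum fun k _ => by simp only [hg]; linarith [hind (T^[k] ω)]
        simp only [birkhoffAverage, smul_eq_mul] at hn
        rw [lt_inv_mul_iff₀ hn0] at hn
        linarith)
  have hL : ∀ L : ℕ, (L : ℝ) * (∫ ω, F ω ∂μ - ε / 2) - M ≤ L * ∫ ω, g ω ∂μ := fun L => by
    obtain ⟨hi, he⟩ := integral_birkhoffSum hT (hf.add hindm) hgi L
    have hFε : Integrable (fun ω => F ω - ε / 2) μ := hFi.sub (integrable_const _)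
    have : ∫ ω, ((L : ℝ) * (F ω - ε / 2) - M) ∂μ ≤ ∫ ω, birkhoffSum T g L ω ∂μ :=
      integral_mono ((hFε.const_mul _).sub (integrable_const _)) hi (hmain L)
    rw [integral_sub (hFε.const_mul _) (integrable_const _),
      integral_const_mul, integral_sub hFi (integrable_const _)] at this
    simp only [integral_const, probReal_univ, smul_eq_mul, one_mul] at this
    exact this.trans he.le
  have key : ∫ ω, F ω ∂μ - ε / 2 ≤ ∫ ω, g ω ∂μ := by
    by_contra! hlt
    obtain ⟨L, hLL⟩ := exists_nat_gt (M / ((∫ ω, F ω ∂μ - ε / 2) - ∫ ω, g ω ∂μ))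
    rw [div_lt_iff₀ (by linarith)] at hLL
    linarith [hL L]
  linarith

/-- Birkhoff's pointwise ergodic theorem for functions with values in `[0,1]`. -/
theorem ae_exists_tendsto_birkhoffAverage [IsProbabilityMeasure μ] (hT : MeasurePreserving T μ μ)
    (hf : Measurable f) (h0 : ∀ ω, 0 ≤ f ω) (h1 : ∀ ω, f ω ≤ 1) :
    ∀ᵐ ω ∂μ, ∃ l, Tendsto (fun n => birkhoffAverage ℝ T f n ω) atTop (𝓝 l) := by
  have h0' : ∀ ω, 0 ≤ 1 - f ω := fun ω => by linarith [h1 ω]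
  have h1' : ∀ ω, 1 - f ω ≤ 1 := fun ω => by linarith [h0 ω]
  have hf' : Measurable fun ω => 1 - f ω := measurable_const.sub hf
  set F := birkhoffLimsup T f with hF
  set F' := birkhoffLimsup T (fun ω => 1 - f ω) with hF'
  have hFi : Integrable F μ := integrable_of_mem_Icc (measurable_birkhoffLimsup hT.measurable hf)
    (birkhoffLimsup_nonneg h0 h1) (birkhoffLimsup_le_one h0 h1)
  have hFi' : Integrable F' μ := integrable_of_mem_Icc
    (measurable_birkhoffLimsup hT.measurable hf')
    (birkhoffLimsup_nonneg h0' h1') (birkhoffLimsup_le_one h0' h1')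
  have hfi : Integrable f μ := integrable_of_mem_Icc hf h0 h1
  have hcompl : ∀ ω, ∀ n, 1 ≤ n →
      birkhoffAverage ℝ T (fun ω => 1 - f ω) n ω = 1 - birkhoffAverage ℝ T f n ω := by
    intro ω n hn
    have : (n : ℝ) ≠ 0 := by positivity
    simp only [birkhoffAverage, birkhoffSum, smul_eq_mul, Finset.sum_sub_distrib]
    field_simp
    simp
  have hev : ∀ ω, ∀ ε > 0, ∀ᶠ n in atTop, birkhoffAverage ℝ T f n ω < F ω + ε ∧
      1 - birkhoffAverage ℝ T f n ω < F' ω + ε := by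
    intro ω ε hε
    have e1 := eventually_lt_of_limsup_lt (show birkhoffLimsup T f ω < F ω + ε by
      rw [← hF]; linarith) (isBoundedUnder_birkhoffAverage h0 h1 ω)
    have e2 := eventually_lt_of_limsup_lt (show birkhoffLimsup T (fun ω => 1 - f ω) ω < F' ω + ε by
      rw [← hF']; linarith) (isBoundedUnder_birkhoffAverage h0' h1' ω)
    filter_upwards [e1, e2, eventually_ge_atTop 1] with n a b c
    exact ⟨a, by rwa [← hcompl ω n c]⟩
  have hge : ∀ ω, 0 ≤ F ω + F' ω - 1 := by
    intro ω
    by_contra! hlt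
    obtain ⟨n, a, b⟩ := (hev ω ((1 - F ω - F' ω) / 2) (by linarith)).exists
    linarith
  have hint : ∫ ω, (F ω + F' ω - 1) ∂μ = 0 := by
    apply le_antisymm _ (integral_nonneg hge)
    have e1 := integral_birkhoffLimsup_le hT hf h0 h1
    have e2 := integral_birkhoffLimsup_le hT hf' h0' h1'
    rw [integral_sub (integrable_const _) hfi] at e2
    have : ∫ ω, (F ω + F' ω - 1) ∂μ = ∫ ω, F ω ∂μ + ∫ ω, F' ω ∂μ - 1 := by
      rw [integral_sub (f := fun ω => F ω + F' ω) (hFi.add hFi') (integrable_const _),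
        integral_add hFi hFi']
      simp
    rw [this]
    simp only [integral_const, probReal_univ, smul_eq_mul, one_mul] at e2
    linarith
  rw [integral_eq_zero_iff_of_nonneg hge ((hFi.add hFi').sub (integrable_const _))] at hint
  filter_upwards [hint] with ω hω
  simp only [Pi.zero_apply] at hω
  refine ⟨F ω, Metric.tendsto_nhds.2 fun ε hε => ?_⟩
  filter_upwards [hev ω ε hε] with n ⟨a, b⟩
  rw [Real.dist_eq, abs_lt]
  constructor <;> linarith

end Birkhoff

section Shift

variable {α : Type*}

theorem iterate_shift (n k : ℕ) (ω : ℕ → α) : (shift^[n] ω) k = ω (n + k) := by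
  induction n generalizing k with
  | zero => simp
  | succ n ih => rw [Function.iterate_succ_apply', shift, ih]; congr 1; ring

theorem measurable_shift [MeasurableSpace α] : Measurable (shift : (ℕ → α) → ℕ → α) :=
  measurable_pi_lambda _ fun n => measurable_pi_apply (n + 1)

end Shift

section Frequency

variable {α : Type*} [Fintype α]

/-- the symbols of `ω` occur with asymptotic frequencies `p` -/
def HasFreq (ω : ℕ → α) (p : α → ℝ) : Prop :=
  ∀ f : α → ℝ, Tendsto (fun n : ℕ => (∑ k ∈ Finset.range n, f (ω k)) / n) atTop
    (𝓝 (∑ a, p a * f a))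

theorem hasFreq_of_indicator {ω : ℕ → α} {p : α → ℝ}
    (h : ∀ a, Tendsto (fun n : ℕ => (∑ k ∈ Finset.range n, if ω k = a then (1 : ℝ) else 0) / n)
      atTop (𝓝 (p a))) : HasFreq ω p := by
  intro f
  have : Tendsto (fun n : ℕ => ∑ a, ((∑ k ∈ Finset.range n, if ω k = a then (1 : ℝ) else 0) / n) *
      f a) atTop (𝓝 (∑ a, p a * f a)) := tendsto_finsetSum _ fun a _ => (h a).mul_const _
  refine this.congr fun n => ?_
  simp_rw [div_mul_eq_mul_div, ← Finset.sum_div, Finset.sum_mul]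
  rw [Finset.sum_comm]
  simp

theorem HasFreq.isProbVec {ω : ℕ → α} {p : α → ℝ} (h : HasFreq ω p) : IsProbVec p := by
  constructor
  · intro a
    have h1 := h (fun b => if b = a then 1 else 0)
    simp only [mul_ite, mul_one, mul_zero, Finset.sum_ite_eq', Finset.mem_univ, if_true] at h1
    exact ge_of_tendsto' h1 fun n => by positivity
  · have h1 := h (fun _ => 1)
    simp only [mul_one, Finset.sum_const, Finset.card_range, nsmul_eq_mul] at h1
    refine tendsto_nhds_unique h1 (tendsto_const_nhds.congr' ?_)
    filter_upwards [eventually_ge_atTop 1] with n hn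
    have : (n : ℝ) ≠ 0 := by positivity
    field_simp

theorem HasFreq.eventually_abs_sum_sub_le {ω : ℕ → α} {p : α → ℝ} (h : HasFreq ω p) (f : α → ℝ)
    {C ε : ℝ} (hC : 0 ≤ C) (hε : 0 < ε) :
    ∀ᶠ N : ℕ in atTop, ∀ n : ℕ, (n : ℝ) ≤ C * N →
      |∑ k ∈ Finset.range n, (f (ω k) - ∑ a, p a * f a)| ≤ ε * N := by
  set S : ℕ → ℝ := fun n => ∑ k ∈ Finset.range n, (f (ω k) - ∑ a, p a * f a) with hS
  obtain ⟨n₀, hn₀⟩ := eventually_atTop.1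
    (Metric.tendsto_nhds.1 (h f) (ε / (C + 1)) (by positivity))
  have hbig : ∀ n, n₀ ≤ n → |S n| ≤ ε / (C + 1) * n := by
    intro n hn
    rcases Nat.eq_zero_or_pos n with rfl | hpos
    · simp [hS]
    · have hn' : (0 : ℝ) < n := by exact_mod_cast hpos
      have h2 := (hn₀ n hn).le
      rw [Real.dist_eq] at h2
      have h3 : S n = ((∑ k ∈ Finset.range n, f (ω k)) / n - ∑ a, p a * f a) * n := by
        simp only [hS, Finset.sum_sub_distrib, Finset.sum_const, Finset.card_range, nsmul_eq_mul]
        field_simp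
      rw [h3, abs_mul, abs_of_pos hn']
      gcongr
  obtain ⟨N₀, hN₀⟩ := exists_nat_gt ((∑ n ∈ Finset.range n₀, |S n|) / ε)
  rw [div_lt_iff₀ hε] at hN₀
  filter_upwards [eventually_ge_atTop N₀] with N hN n hn
  change |S n| ≤ ε * N
  by_cases hlt : n < n₀
  · have h1 : |S n| ≤ ∑ n ∈ Finset.range n₀, |S n| :=
      Finset.single_le_sum (f := fun n => |S n|) (fun _ _ => abs_nonneg _)
        (Finset.mem_range.2 hlt)
    have h2 : (N₀ : ℝ) ≤ N := by exact_mod_cast hN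
    nlinarith
  · refine (hbig n (not_lt.1 hlt)).trans ?_
    have h2 : ε / (C + 1) * n ≤ ε / (C + 1) * (C * N) := by gcongr
    refine h2.trans ?_
    rw [div_mul_eq_mul_div, div_le_iff₀ (by positivity)]
    have : (0 : ℝ) ≤ ε * N := by positivity
    nlinarith

/-- the coordinates that are still active at time `k` when coordinate `i` stops at time `m i` -/
noncomputable def activeIdx {d : ℕ} (m : Fin d → ℕ) (k : ℕ) : Finset (Fin d) :=
  Finset.univ.filter fun i => k < m i

theorem exists_filter_activeIdx_eq_Ico {d : ℕ} (m : Fin d → ℕ) (K : ℕ) (I : Finset (Fin d)) :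
    ∃ s t, t ≤ K ∧ (Finset.range K).filter (fun k => activeIdx m k = I) = Finset.Ico s t := by
  refine ⟨Iᶜ.sup m, (insert K (I.image m)).min' (Finset.insert_nonempty _ _),
    Finset.min'_le _ _ (Finset.mem_insert_self _ _), ?_⟩
  ext k
  simp only [Finset.mem_filter, Finset.mem_range, Finset.mem_Ico, Finset.sup_le_iff,
    Finset.lt_min'_iff, Finset.mem_insert, Finset.mem_image, Finset.mem_compl, activeIdx,
    Finset.ext_iff, Finset.mem_univ, true_and]
  constructor
  · rintro ⟨hk, h⟩
    refine ⟨fun i hi => not_lt.1 fun hlt => hi ((h i).1 hlt), ?_⟩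
    rintro b (rfl | ⟨i, hi, rfl⟩)
    · exact hk
    · exact (h i).2 hi
  · rintro ⟨h1, h2⟩
    exact ⟨h2 K (Or.inl rfl), fun i =>
      ⟨fun hlt => by_contra fun hi => absurd (h1 i hi) (not_le.2 hlt),
      fun hi => h2 _ (Or.inr ⟨i, hi, rfl⟩)⟩⟩

theorem HasFreq.eventually_abs_sum_activeIdx_le {d : ℕ} {ω : ℕ → α} {p : α → ℝ} (h : HasFreq ω p)
    (f : Finset (Fin d) → α → ℝ) (m : ℕ → Fin d → ℕ) (K : ℕ → ℕ) {C ε : ℝ} (hC : 0 ≤ C)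
    (hε : 0 < ε) (hK : ∀ᶠ N in atTop, (K N : ℝ) ≤ C * N) :
    ∀ᶠ N : ℕ in atTop, |∑ k ∈ Finset.range (K N), (f (activeIdx (m N) k) (ω k) -
      ∑ a, p a * f (activeIdx (m N) k) a)| ≤ ε * N := by
  set c : ℝ := ((Fintype.card (Finset (Fin d)) : ℕ) : ℝ) with hc
  have hc0 : 0 < c := by simp only [hc]; exact_mod_cast Fintype.card_pos
  have h1 : ∀ᶠ N : ℕ in atTop, ∀ I, ∀ n : ℕ, (n : ℝ) ≤ C * N →
      |∑ k ∈ Finset.range n, (f I (ω k) - ∑ a, p a * f I a)| ≤ ε / (2 * c) * N :=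
    eventually_all.2 fun I => h.eventually_abs_sum_sub_le (f I) hC (by positivity)
  filter_upwards [h1, hK] with N hN hKN
  rw [← Finset.sum_fiberwise (Finset.range (K N)) (activeIdx (m N))]
  refine (Finset.abs_sum_le_sum_abs _ _).trans ?_
  have h2 : ∀ I : Finset (Fin d), |∑ k ∈ (Finset.range (K N)).filter
      (fun k => activeIdx (m N) k = I), (f (activeIdx (m N) k) (ω k) -
      ∑ a, p a * f (activeIdx (m N) k) a)| ≤ ε / c * N := by
    intro I
    rw [Finset.sum_congr rfl (g := fun k => f I (ω k) - ∑ a, p a * f I a)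
      (fun k hk => by rw [(Finset.mem_filter.1 hk).2])]
    obtain ⟨s, t, htK, hst⟩ := exists_filter_activeIdx_eq_Ico (m N) (K N) I
    rw [hst]
    rcases le_total t s with hts | hst'
    · rw [Finset.Ico_eq_empty_of_le hts]; simp; positivity
    · rw [Finset.sum_Ico_eq_sub _ hst']
      have e1 := hN I t (le_trans (by exact_mod_cast htK) hKN)
      have e2 := hN I s (le_trans (by exact_mod_cast hst'.trans htK) hKN)
      refine (abs_sub _ _).trans ((add_le_add e1 e2).trans (le_of_eq ?_))
      field_simp
      ring
  refine (Finset.sum_le_sum fun I _ => h2 I).trans (le_of_eq ?_)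
  rw [Finset.sum_const, Finset.card_univ, nsmul_eq_mul, ← hc]
  field_simp

theorem ae_exists_hasFreq [MeasurableSpace α] [DiscreteMeasurableSpace α] {μ : Measure (ℕ → α)}
    [IsProbabilityMeasure μ] (hμ : Measure.map shift μ = μ) : ∀ᵐ ω ∂μ, ∃ p, HasFreq ω p := by
  have hT : MeasurePreserving shift μ μ := ⟨measurable_shift, hμ⟩
  have h1 : ∀ a : α, ∀ᵐ ω ∂μ, ∃ l, Tendsto (fun n => birkhoffAverage ℝ shift
      (fun ω : ℕ → α => if ω 0 = a then (1 : ℝ) else 0) n ω) atTop (𝓝 l) := fun a =>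
    ae_exists_tendsto_birkhoffAverage hT
      ((Measurable.of_discrete (f := fun b : α => if b = a then (1 : ℝ) else 0)).comp
        (measurable_pi_apply 0)) (fun ω => by positivity) (fun ω => by split_ifs <;> norm_num)
  filter_upwards [ae_all_iff.2 h1] with ω hω
  choose p hp using hω
  refine ⟨p, hasFreq_of_indicator fun a => (hp a).congr fun n => ?_⟩
  simp only [birkhoffAverage, birkhoffSum, iterate_shift, add_zero, smul_eq_mul]
  rw [div_eq_inv_mul]

end Frequency

namespace DiagIFS

/-- the composition `φ_{i,w_0} ∘ ⋯ ∘ φ_{i,w_{n-1}}` -/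
noncomputable def wordMap (Φ : DiagIFS d A) (i : Fin d) : ℕ → (ℕ → A i) → ℝ → ℝ
  | 0, _, x => x
  | n + 1, w, x => Φ.base i (w 0) (wordMap Φ i n (shift w) x)

/-- the derivative of `wordMap` -/
def wordSlope (Φ : DiagIFS d A) (i : Fin d) (n : ℕ) (w : ℕ → A i) : ℝ :=
  ∏ k ∈ Finset.range n, Φ.slope i (w k)

/-- the sequence of `i`-th coordinates of a sequence of symbols -/
def coordSeq (Φ : DiagIFS d A) (ω : ℕ → Φ.Symb) (i : Fin d) : ℕ → A i :=
  fun k => (ω k).1 i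

variable {Φ : DiagIFS d A} {i : Fin d}

theorem wordSlope_succ (n : ℕ) (w : ℕ → A i) :
    Φ.wordSlope i (n + 1) w = Φ.slope i (w 0) * Φ.wordSlope i n (shift w) := by
  simp only [wordSlope, shift]
  rw [Finset.prod_range_succ', mul_comm]

theorem wordMap_eq (n : ℕ) (w : ℕ → A i) (x : ℝ) :
    Φ.wordMap i n w x = Φ.wordSlope i n w * x + Φ.wordMap i n w 0 := by
  induction n generalizing w with
  | zero => simp [wordMap, wordSlope]
  | succ n ih =>
    simp only [wordMap, base]
    rw [ih (shift w), wordSlope_succ]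
    ring

theorem wordMap_zero_eq_sum (n : ℕ) (w : ℕ → A i) :
    Φ.wordMap i n w 0 = ∑ m ∈ Finset.range n,
      (∏ k ∈ Finset.range m, Φ.slope i (w k)) * Φ.off i (w m) := by
  induction n generalizing w with
  | zero => simp [wordMap]
  | succ n ih =>
    simp only [wordMap, base]
    rw [ih (shift w), Finset.sum_range_succ', Finset.mul_sum]
    simp only [shift, Finset.range_zero, Finset.prod_empty, one_mul]
    congr 1
    refine Finset.sum_congr rfl fun m _ => ?_
    rw [Finset.prod_range_succ']
    ring

theorem Valid.wordMap_mem_Icc (hV : Φ.Valid) (n : ℕ) (w : ℕ → A i) {x : ℝ}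
    (hx : x ∈ Icc (0 : ℝ) 1) : Φ.wordMap i n w x ∈ Icc (0 : ℝ) 1 := by
  induction n generalizing w with
  | zero => exact hx
  | succ n ih => exact hV.2.2.2 i _ _ (ih _)

theorem Valid.base_mem_Ioo (hV : Φ.Valid) (a : A i) {x : ℝ}
    (hx : x ∈ Ioo (0 : ℝ) 1) : Φ.base i a x ∈ Ioo (0 : ℝ) 1 := by
  have h0 := hV.2.2.2 i a 0 ⟨le_rfl, zero_le_one⟩
  have h1 := hV.2.2.2 i a 1 ⟨zero_le_one, le_rfl⟩
  have hs := hV.2.1 i a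
  simp only [base, mem_Icc, mul_zero, mul_one, zero_add] at h0 h1
  simp only [base, mem_Ioo]
  obtain ⟨hx0, hx1⟩ := hx
  rcases lt_or_gt_of_ne hs with hs | hs <;> constructor <;> nlinarith

theorem Valid.wordMap_mem_Ioo (hV : Φ.Valid) (n : ℕ) (w : ℕ → A i) {x : ℝ}
    (hx : x ∈ Ioo (0 : ℝ) 1) : Φ.wordMap i n w x ∈ Ioo (0 : ℝ) 1 := by
  induction n generalizing w with
  | zero => exact hx
  | succ n ih => exact hV.base_mem_Ioo _ (ih _)

theorem Baranski.eq_of_wordMap_eq (hB : Φ.Baranski) (hV : Φ.Valid) {n : ℕ} {w w' : ℕ → A i}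
    {x x' : ℝ} (hx : x ∈ Ioo (0 : ℝ) 1) (hx' : x' ∈ Ioo (0 : ℝ) 1)
    (h : Φ.wordMap i n w x = Φ.wordMap i n w' x') : ∀ k < n, w k = w' k := by
  induction n generalizing w w' with
  | zero => intro k hk; omega
  | succ n ih =>
    simp only [wordMap] at h
    have h0 : w 0 = w' 0 := by
      by_contra hne
      refine disjoint_left.1 (hB i _ _ hne) ⟨_, hV.wordMap_mem_Ioo n (shift w) hx, rfl⟩ ?_
      rw [h]
      exact ⟨_, hV.wordMap_mem_Ioo n (shift w') hx', rfl⟩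
    rw [h0] at h
    simp only [base, add_left_inj] at h
    have h1 := ih (mul_left_cancel₀ (hV.2.1 i _) h)
    intro k hk
    cases k with
    | zero => exact h0
    | succ k => exact h1 k (by omega)

theorem Valid.exists_slope_le (hV : Φ.Valid) :
    ∃ r : ℝ, 0 ≤ r ∧ r < 1 ∧ ∀ i a, |Φ.slope i a| ≤ r := by
  have h : ∀ᶠ r : ℝ in 𝓝[<] 1, r < 1 ∧ 0 ≤ r ∧ ∀ i a, |Φ.slope i a| ≤ r := by
    refine eventually_mem_nhdsWithin.and ((eventually_nhdsWithin_of_eventually_nhds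
      ((lt_mem_nhds zero_lt_one).mono fun _ => le_of_lt)).and ?_)
    exact eventually_all.2 fun i => eventually_all.2 fun a =>
      eventually_nhdsWithin_of_eventually_nhds
        ((lt_mem_nhds (hV.2.2.1 i a)).mono fun _ => le_of_lt)
  obtain ⟨r, h1, h2, h3⟩ := h.exists
  exact ⟨r, h2, h1, h3⟩

theorem Valid.neg_log_slope_pos (hV : Φ.Valid) (i : Fin d) (a : A i) :
    0 < -Real.log |Φ.slope i a| :=
  neg_pos.2 (Real.log_neg (abs_pos.2 (hV.2.1 i a)) (hV.2.2.1 i a))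

theorem Valid.exists_le_neg_log_slope (hV : Φ.Valid) :
    ∃ κ : ℝ, 0 < κ ∧ ∀ i a, κ ≤ -Real.log |Φ.slope i a| := by
  have h : ∀ᶠ r : ℝ in 𝓝[>] 0, 0 < r ∧ ∀ i a, r ≤ -Real.log |Φ.slope i a| :=
    eventually_mem_nhdsWithin.and (eventually_all.2 fun i => eventually_all.2 fun a =>
      eventually_nhdsWithin_of_eventually_nhds
        ((gt_mem_nhds (hV.neg_log_slope_pos i a)).mono fun _ => le_of_lt))
  exact h.exists

theorem Valid.summable_coding (hV : Φ.Valid) (w : ℕ → A i) :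
    Summable fun m : ℕ => (∏ k ∈ Finset.range m, Φ.slope i (w k)) * Φ.off i (w m) := by
  obtain ⟨r, hr0, hr1, hr⟩ := hV.exists_slope_le
  refine Summable.of_norm_bounded (summable_geometric_of_lt_one hr0 hr1) fun m => ?_
  rw [norm_mul, norm_prod]
  have h1 : ∏ k ∈ Finset.range m, ‖Φ.slope i (w k)‖ ≤ r ^ m := by
    have := Finset.prod_le_prod (s := Finset.range m) (fun k _ => norm_nonneg (Φ.slope i (w k)))
      (fun k _ => (Real.norm_eq_abs _).trans_le (hr i (w k)))
    simpa using this
  have h2 : ‖Φ.off i (w m)‖ ≤ 1 := by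
    have := hV.2.2.2 i (w m) 0 ⟨le_rfl, zero_le_one⟩
    simp only [base, mul_zero, zero_add] at this
    rw [Real.norm_of_nonneg this.1]; exact this.2
  calc _ ≤ r ^ m * 1 := mul_le_mul h1 h2 (norm_nonneg _) (by positivity)
    _ = r ^ m := mul_one _

theorem Valid.tendsto_wordMap (hV : Φ.Valid) (ω : ℕ → Φ.Symb) (i : Fin d) :
    Tendsto (fun n => Φ.wordMap i n (Φ.coordSeq ω i) 0) atTop (𝓝 (Φ.coding ω i)) := by
  simp_rw [wordMap_zero_eq_sum]
  exact (hV.summable_coding (Φ.coordSeq ω i)).hasSum.tendsto_sum_nat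

theorem Valid.coding_mem_Icc (hV : Φ.Valid) (ω : ℕ → Φ.Symb) (i : Fin d) :
    Φ.coding ω i ∈ Icc (0 : ℝ) 1 :=
  isClosed_Icc.mem_of_tendsto (hV.tendsto_wordMap ω i)
    (Eventually.of_forall fun n => hV.wordMap_mem_Icc n _ ⟨le_rfl, zero_le_one⟩)

theorem Valid.coding_eq_base (hV : Φ.Valid) (ω : ℕ → Φ.Symb) (i : Fin d) :
    Φ.coding ω i = Φ.base i ((ω 0).1 i) (Φ.coding (shift ω) i) := by
  have h1 := (hV.tendsto_wordMap ω i).comp (tendsto_add_atTop_nat 1)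
  have h2 := ((hV.tendsto_wordMap (shift ω) i).const_mul (Φ.slope i ((ω 0).1 i))).add_const
    (Φ.off i ((ω 0).1 i))
  exact tendsto_nhds_unique h1 h2

theorem Valid.exists_coding_eq_wordMap (hV : Φ.Valid) (n : ℕ) (ω : ℕ → Φ.Symb) (i : Fin d) :
    ∃ x ∈ Icc (0 : ℝ) 1, Φ.coding ω i = Φ.wordMap i n (Φ.coordSeq ω i) x := by
  induction n generalizing ω with
  | zero => exact ⟨_, hV.coding_mem_Icc ω i, rfl⟩
  | succ n ih =>
    obtain ⟨x, hx, h⟩ := ih (shift ω)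
    refine ⟨x, hx, ?_⟩
    rw [hV.coding_eq_base, h]
    rfl

theorem Valid.measurable_coding (hV : Φ.Valid) : Measurable Φ.coding := by
  refine measurable_pi_lambda _ fun i => ?_
  refine measurable_of_tendsto_metrizable (f := fun n ω => Φ.wordMap i n (Φ.coordSeq ω i) 0)
    (fun n => ?_) (tendsto_pi_nhds.2 fun ω => hV.tendsto_wordMap ω i)
  simp_rw [wordMap_zero_eq_sum]
  have h1 : ∀ k, Measurable fun ω : ℕ → Φ.Symb => Φ.slope i (Φ.coordSeq ω i k) := fun k =>
    (measurable_from_top (f := fun a : Φ.Symb => Φ.slope i (a.1 i))).comp (measurable_pi_apply k)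
  have h2 : ∀ k, Measurable fun ω : ℕ → Φ.Symb => Φ.off i (Φ.coordSeq ω i k) := fun k =>
    (measurable_from_top (f := fun a : Φ.Symb => Φ.off i (a.1 i))).comp (measurable_pi_apply k)
  exact Finset.measurable_fun_sum _ fun m _ =>
    (Finset.measurable_fun_prod _ fun k _ => h1 k).mul (h2 m)

/-- the sequences agreeing with `ω` in coordinate `i` up to time `m i`, for every `i` -/
def cyl (Φ : DiagIFS d A) (m : Fin d → ℕ) (ω : ℕ → Φ.Symb) : Set (ℕ → Φ.Symb) :=
  {τ | ∀ i, ∀ k < m i, (τ k).1 i = (ω k).1 i}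

theorem wordMap_congr {n : ℕ} {w w' : ℕ → A i} (h : ∀ k < n, w k = w' k) (x : ℝ) :
    Φ.wordMap i n w x = Φ.wordMap i n w' x := by
  induction n generalizing w w' with
  | zero => rfl
  | succ n ih =>
    simp only [wordMap]
    rw [h 0 (by omega), ih (w := shift w) (w' := shift w') fun k hk => h (k + 1) (by omega)]

theorem Valid.abs_coding_sub_le (hV : Φ.Valid) {m : Fin d → ℕ} {ω τ : ℕ → Φ.Symb}
    (h : τ ∈ Φ.cyl m ω) (i : Fin d) :
    |Φ.coding τ i - Φ.coding ω i| ≤ |Φ.wordSlope i (m i) (Φ.coordSeq ω i)| := by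
  obtain ⟨x, hx, hx'⟩ := hV.exists_coding_eq_wordMap (m i) ω i
  obtain ⟨y, hy, hy'⟩ := hV.exists_coding_eq_wordMap (m i) τ i
  rw [hx', hy', wordMap_congr (w := Φ.coordSeq τ i) (w' := Φ.coordSeq ω i) (h i),
    wordMap_eq _ _ x, wordMap_eq _ _ y, add_sub_add_right_eq_sub, ← mul_sub, abs_mul]
  have : |y - x| ≤ 1 := abs_le.2 ⟨by linarith [hx.2, hy.1], by linarith [hx.1, hy.2]⟩
  exact mul_le_of_le_one_right (abs_nonneg _) this

theorem Valid.exists_grid_point (hV : Φ.Valid) {n : ℕ} {ω : ℕ → Φ.Symb} {y L : ℝ} (hL : 0 < L)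
    (hslope : L ≤ |Φ.wordSlope i n (Φ.coordSeq ω i)|) (hy : |Φ.coding ω i - y| ≤ L) :
    ∃ j ∈ Finset.Icc (-4 : ℤ) 4, ∃ x ∈ Ioo (0 : ℝ) 1,
      Φ.wordMap i n (Φ.coordSeq ω i) x = y + j * (L / 2) := by
  obtain ⟨u, hu, hu'⟩ := hV.exists_coding_eq_wordMap n ω i
  set P := Φ.wordSlope i n (Φ.coordSeq ω i) with hP
  set c := Φ.wordMap i n (Φ.coordSeq ω i) 0 with hc
  have hmap : ∀ x, Φ.wordMap i n (Φ.coordSeq ω i) x = P * x + c := fun x => wordMap_eq _ _ _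
  rw [hmap] at hu'
  rw [hu', abs_le] at hy
  have hP0 : P ≠ 0 := abs_pos.1 (hL.trans_le hslope)
  obtain ⟨hu0, hu1⟩ := hu
  have hv : ∃ v, y - 2 * L ≤ v ∧ v ≤ y + L ∧ ∀ t, v < t → t < v + L →
      ∃ x ∈ Ioo (0 : ℝ) 1, P * x + c = t := by
    have hL1 : 0 ≤ 1 - u := by linarith
    have hLu : L * u ≤ L := by nlinarith
    have hLu' : 0 ≤ L * u := by positivity
    rcases lt_or_gt_of_ne hP0 with hneg | hpos
    · rw [abs_of_neg hneg] at hslope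
      have hk : 0 ≤ (-P - L) * u := mul_nonneg (by linarith) hu0
      have hk' : 0 ≤ (-P - L) * (1 - u) := mul_nonneg (by linarith) hL1
      refine ⟨P * u + c - L * (1 - u), by nlinarith, by nlinarith, fun t ht ht' =>
        ⟨(t - c) / P, ⟨?_, ?_⟩, by field_simp; ring⟩⟩
      · exact div_pos_of_neg_of_neg (by nlinarith) hneg
      · rw [div_lt_one_of_neg hneg]; nlinarith
    · rw [abs_of_pos hpos] at hslope
      have hk : 0 ≤ (P - L) * u := mul_nonneg (by linarith) hu0
      have hk' : 0 ≤ (P - L) * (1 - u) := mul_nonneg (by linarith) hL1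
      refine ⟨P * u + c - L * u, by nlinarith, by nlinarith, fun t ht ht' =>
        ⟨(t - c) / P, ⟨?_, ?_⟩, by field_simp; ring⟩⟩
      · exact div_pos (by nlinarith) hpos
      · rw [div_lt_one hpos]; nlinarith
  obtain ⟨v, hv1, hv2, hv3⟩ := hv
  have hfl := Int.floor_le ((v - y) / (L / 2))
  have hlt := Int.lt_floor_add_one ((v - y) / (L / 2))
  rw [le_div_iff₀ (by positivity)] at hfl
  rw [div_lt_iff₀ (by positivity)] at hlt
  have hb1 : (-4 : ℤ) ≤ ⌊(v - y) / (L / 2)⌋ := by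
    rw [Int.le_floor, le_div_iff₀ (by positivity)]; push_cast; linarith
  have hb2 : ⌊(v - y) / (L / 2)⌋ < 3 := by
    rw [Int.floor_lt, div_lt_iff₀ (by positivity)]; push_cast; linarith
  obtain ⟨x, hx, hx'⟩ := hv3 (y + (⌊(v - y) / (L / 2)⌋ + 1 : ℤ) * (L / 2))
    (by push_cast; linarith) (by push_cast; linarith)
  exact ⟨⌊(v - y) / (L / 2)⌋ + 1, Finset.mem_Icc.2 ⟨by omega, by omega⟩, x, hx,
    (hmap x).trans hx'⟩

theorem Baranski.measure_inter_le (hB : Φ.Baranski) (hV : Φ.Valid) {μ : Measure (ℕ → Φ.Symb)}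
    {m : Fin d → ℕ} {L : ℝ} (hL : 0 < L) {b : ℝ≥0∞} {T : Set (ℕ → Φ.Symb)}
    (hslope : ∀ ω ∈ T, ∀ i, L ≤ |Φ.wordSlope i (m i) (Φ.coordSeq ω i)|)
    (hb : ∀ ω ∈ T, μ (Φ.cyl m ω) ≤ b) (y : Fin d → ℝ) :
    μ (T ∩ {ω | ∀ i, |Φ.coding ω i - y i| ≤ L}) ≤ 9 ^ d * b := by
  set D : (Fin d → ℤ) → Set (ℕ → Φ.Symb) := fun j => {ω | ω ∈ T ∧ ∀ i, ∃ x ∈ Ioo (0 : ℝ) 1,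
    Φ.wordMap i (m i) (Φ.coordSeq ω i) x = y i + j i * (L / 2)} with hD
  have hsub : T ∩ {ω | ∀ i, |Φ.coding ω i - y i| ≤ L} ⊆
      ⋃ j ∈ Fintype.piFinset (fun _ : Fin d => Finset.Icc (-4 : ℤ) 4), D j := by
    rintro ω ⟨hωT, hω⟩
    choose j hj hx using fun i => hV.exists_grid_point hL (hslope ω hωT i) (hω i)
    exact mem_iUnion₂.2 ⟨j, Fintype.mem_piFinset.2 hj, hωT, hx⟩
  have hDb : ∀ j, μ (D j) ≤ b := by
    intro j
    rcases (D j).eq_empty_or_nonempty with he | ⟨ω, hω⟩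
    · simp [he]
    · refine (measure_mono fun τ hτ i k hk => ?_).trans (hb ω hω.1)
      obtain ⟨x, hx, hx'⟩ := hτ.2 i
      obtain ⟨z, hz, hz'⟩ := hω.2 i
      exact hB.eq_of_wordMap_eq hV hx hz (hx'.trans hz'.symm) k hk
  refine (measure_mono hsub).trans ((measure_biUnion_finset_le _ _).trans
    ((Finset.sum_le_sum fun j _ => hDb j).trans (le_of_eq ?_)))
  rw [Finset.sum_const, Fintype.card_piFinset]
  simp [nsmul_eq_mul]

end DiagIFS

/-- the sequences starting with the first `n` letters of `w` -/
def prefixCyl {α : Type*} (n : ℕ) (w : ℕ → α) : Set (ℕ → α) := {ω | ∀ k < n, ω k = w k}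

theorem measurableSet_prefixCyl {α : Type*} [MeasurableSpace α] [DiscreteMeasurableSpace α]
    (n : ℕ) (w : ℕ → α) : MeasurableSet (prefixCyl n w) := by
  have : prefixCyl n w = ⋂ k, ⋂ (_ : k < n), (fun ω : ℕ → α => ω k) ⁻¹' {w k} := by
    ext ω; simp [prefixCyl]
  rw [this]
  exact MeasurableSet.iInter fun k => MeasurableSet.iInter fun _ =>
    measurable_pi_apply k MeasurableSet.of_discrete

theorem shift_preimage_prefixCyl {α : Type*} (n : ℕ) (w : ℕ → α) :
    shift ⁻¹' prefixCyl n w = ⋃ a, prefixCyl (n + 1) (fun k => Nat.casesOn k a w) := by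
  ext ω
  simp only [prefixCyl, shift, mem_preimage, mem_ofPred_eq, mem_iUnion]
  constructor
  · intro h
    refine ⟨ω 0, fun k hk => ?_⟩
    cases k with
    | zero => rfl
    | succ k => exact h k (by omega)
  · rintro ⟨a, h⟩ k hk
    exact h (k + 1) (by omega)

section SequenceMeasures

variable {α : Type*} [Fintype α] [MeasurableSpace α] [DiscreteMeasurableSpace α]

/-- the measure on a finite type with density `q` -/
noncomputable def vecMeasure (q : α → ℝ) : Measure α :=
  ∑ a, ENNReal.ofReal (q a) • Measure.dirac a

theorem vecMeasure_apply {q : α → ℝ} (hq : ∀ a, 0 ≤ q a) (s : Set α) :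
    vecMeasure q s = ENNReal.ofReal (∑ a, if a ∈ s then q a else 0) := by
  rw [vecMeasure, Measure.finsetSum_apply, ENNReal.ofReal_sum_of_nonneg fun a _ => by
    split_ifs <;> simp [hq a]]
  refine Finset.sum_congr rfl fun a _ => ?_
  rw [Measure.smul_apply, Measure.dirac_apply' _ (MeasurableSet.of_discrete)]
  by_cases h : a ∈ s <;> simp [h]

theorem IsProbVec.isProbabilityMeasure_vecMeasure {q : α → ℝ} (hq : IsProbVec q) :
    IsProbabilityMeasure (vecMeasure q) :=
  ⟨by rw [vecMeasure_apply hq.1]; simp [hq.2]⟩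

/-- the Bernoulli measure on `α^ℕ` -/
noncomputable def bernoulli (q : α → ℝ) : Measure (ℕ → α) :=
  Measure.infinitePi fun _ => vecMeasure q

theorem IsProbVec.isProbabilityMeasure_bernoulli {q : α → ℝ} (hq : IsProbVec q) :
    IsProbabilityMeasure (bernoulli q) := by
  have := hq.isProbabilityMeasure_vecMeasure
  unfold bernoulli
  infer_instance

theorem IsProbVec.bernoulli_pi {q : α → ℝ} (hq : IsProbVec q) (s : Finset ℕ) (t : ℕ → Set α) :
    bernoulli q (Set.pi s t) = ∏ k ∈ s, ENNReal.ofReal (∑ a, if a ∈ t k then q a else 0) := by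
  have := hq.isProbabilityMeasure_vecMeasure
  rw [bernoulli, Measure.infinitePi_pi _ fun _ _ => MeasurableSet.of_discrete]
  exact Finset.prod_congr rfl fun k _ => vecMeasure_apply hq.1 _

theorem IsProbVec.ae_hasFreq_bernoulli {q : α → ℝ} (hq : IsProbVec q) :
    ∀ᵐ ω ∂(bernoulli q), HasFreq ω q := by
  have := hq.isProbabilityMeasure_vecMeasure
  have := hq.isProbabilityMeasure_bernoulli
  have h : ∀ a : α, ∀ᵐ ω ∂(bernoulli q), Tendsto (fun n : ℕ =>
      (∑ k ∈ Finset.range n, if ω k = a then (1 : ℝ) else 0) / n) atTop (𝓝 (q a)) := by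
    intro a
    set g : α → ℝ := fun b => if b = a then 1 else 0 with hg
    have hgm : Measurable g := Measurable.of_discrete
    have hid : ∀ k, ProbabilityTheory.IdentDistrib (fun ω : ℕ → α => g (ω k))
        (fun ω : ℕ → α => g (ω 0)) (bernoulli q) (bernoulli q) := by
      intro k
      refine ProbabilityTheory.IdentDistrib.comp (f := fun ω : ℕ → α => ω k)
        (g := fun ω : ℕ → α => ω 0) ⟨(measurable_pi_apply k).aemeasurable,
        (measurable_pi_apply 0).aemeasurable, ?_⟩ hgm
      rw [bernoulli, Measure.infinitePi_map_eval, Measure.infinitePi_map_eval]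
    have hint : Integrable (fun ω : ℕ → α => g (ω 0)) (bernoulli q) :=
      integrable_of_mem_Icc (hgm.comp (measurable_pi_apply 0))
        (fun ω => by simp only [hg]; positivity)
        (fun ω => by simp only [hg]; split_ifs <;> norm_num)
    have hmean : ∫ ω : ℕ → α, g (ω 0) ∂(bernoulli q) = q a := by
      have e : (fun ω : ℕ → α => g (ω 0)) =
          (Set.pi (({0} : Finset ℕ) : Set ℕ) fun _ => {a}).indicator fun _ => (1 : ℝ) := by
        ext ω
        simp [hg, indicator]
      rw [e, integral_indicator (MeasurableSet.pi (Finset.countable_toSet _)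
        fun _ _ => MeasurableSet.of_discrete), setIntegral_const, Measure.real, hq.bernoulli_pi]
      simp [ENNReal.toReal_ofReal (hq.1 a)]
    have hind : ProbabilityTheory.iIndepFun (fun k (ω : ℕ → α) => g (ω k)) (bernoulli q) :=
      ProbabilityTheory.iIndepFun_infinitePi (P := fun _ : ℕ => vecMeasure q)
        (X := fun _ => g) fun _ => hgm
    have := ProbabilityTheory.strong_law_ae_real _ hint
      (fun i j hij => hind.indepFun hij) hid
    rw [hmean] at this
    exact this
  filter_upwards [ae_all_iff.2 h] with ω hω using hasFreq_of_indicator hω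

theorem ext_of_prefixCyl {μ ν : Measure (ℕ → α)} [IsFiniteMeasure μ]
    (h : ∀ n w, μ (prefixCyl n w) = ν (prefixCyl n w)) : μ = ν := by
  rcases isEmpty_or_nonempty (ℕ → α) with he | ⟨⟨w₀⟩⟩
  · ext s _; simp [Set.eq_empty_of_isEmpty s]
  refine ext_of_generate_finite {s | ∃ n w, s = prefixCyl n w} (le_antisymm ?_ ?_) ?_ ?_ ?_
  · refine iSup_le fun k => ?_
    rw [← measurable_iff_comap_le]
    refine @measurable_to_countable' _ _ _ _ (MeasurableSpace.generateFrom _) _ fun a => ?_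
    have : (fun ω : ℕ → α => ω k) ⁻¹' {a} = ⋃ v ∈ {v : Fin (k + 1) → α | v (Fin.last k) = a},
        prefixCyl (k + 1) (fun j => if h : j < k + 1 then v ⟨j, h⟩ else a) := by
      ext ω
      simp only [mem_preimage, mem_singleton_iff, mem_iUnion, prefixCyl, mem_ofPred_eq]
      constructor
      · intro h
        exact ⟨fun j => ω j, h, fun j hj => by simp [hj]⟩
      · rintro ⟨v, hv, h⟩
        rw [h k (by omega), dif_pos (by omega), ← hv]
        rfl
    rw [this]
    exact MeasurableSet.biUnion (Set.to_countable _) fun v _ =>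
      MeasurableSpace.measurableSet_generateFrom ⟨_, _, rfl⟩
  · refine MeasurableSpace.generateFrom_le ?_
    rintro _ ⟨n, w, rfl⟩
    exact measurableSet_prefixCyl n w
  · rintro _ ⟨n, w, rfl⟩ _ ⟨n', w', rfl⟩ ⟨x, hx, hx'⟩
    refine ⟨max n n', x, ?_⟩
    ext ω
    simp only [prefixCyl, mem_inter_iff, mem_ofPred_eq] at hx hx' ⊢
    constructor
    · rintro ⟨h1, h2⟩ k hk
      rcases lt_max_iff.1 hk with hk | hk
      · rw [h1 k hk, hx k hk]
      · rw [h2 k hk, hx' k hk]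
    · intro h
      exact ⟨fun k hk => by rw [h k (lt_max_of_lt_left hk), hx k hk],
        fun k hk => by rw [h k (lt_max_of_lt_right hk), hx' k hk]⟩
  · rintro _ ⟨n, w, rfl⟩
    exact h n w
  · have := h 0 w₀
    simpa [prefixCyl] using this

theorem map_shift_eq_of_prefixCyl {μ : Measure (ℕ → α)} [IsProbabilityMeasure μ] {q : α → ℝ}
    (hq : IsProbVec q)
    (h : ∀ n w, (μ (prefixCyl n w)).toReal = ∏ k ∈ Finset.range n, q (w k)) :
    Measure.map shift μ = μ := by
  have : IsProbabilityMeasure (Measure.map shift μ) :=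
    Measure.isProbabilityMeasure_map measurable_shift.aemeasurable
  refine ext_of_prefixCyl fun n w => ?_
  rw [Measure.map_apply measurable_shift (measurableSet_prefixCyl n w), shift_preimage_prefixCyl,
    measure_iUnion _ fun a => measurableSet_prefixCyl _ _, tsum_fintype]
  · rw [← ENNReal.toReal_eq_toReal_iff' (by simp) (by simp),
      ENNReal.toReal_sum (by simp)]
    simp_rw [h, Finset.prod_range_succ']
    rw [← Finset.mul_sum]
    exact (congrArg _ hq.2).trans (mul_one _)
  · intro a b hab
    refine disjoint_left.2 fun ω hω hω' => hab ?_
    exact (hω 0 (by omega)).symm.trans (hω' 0 (by omega))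

end SequenceMeasures

theorem measure_lt_mul_measure_le {Ω ι : Type*} [MeasurableSpace Ω] [Finite ι]
    {μ ν : Measure Ω} [IsProbabilityMeasure ν] {F : Ω → ι}
    (hF : ∀ c, MeasurableSet (F ⁻¹' {c})) (r : ℝ≥0∞) :
    μ {ω | μ (F ⁻¹' {F ω}) < r * ν (F ⁻¹' {F ω})} ≤ r := by
  have := Fintype.ofFinite ι
  set B : Finset ι := Finset.univ.filter fun c => μ (F ⁻¹' {c}) < r * ν (F ⁻¹' {c}) with hB
  have hsub : {ω | μ (F ⁻¹' {F ω}) < r * ν (F ⁻¹' {F ω})} ⊆ F ⁻¹' (B : Set ι) := by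
    intro ω hω
    simpa [hB] using hω
  refine (measure_mono hsub).trans ?_
  rw [← sum_measure_preimage_singleton B fun c _ => hF c]
  calc ∑ c ∈ B, μ (F ⁻¹' {c}) ≤ ∑ c ∈ B, r * ν (F ⁻¹' {c}) :=
        Finset.sum_le_sum fun c hc => (Finset.mem_filter.1 hc).2.le
    _ = r * ν (F ⁻¹' (B : Set ι)) := by
        rw [← Finset.mul_sum, sum_measure_preimage_singleton B fun c _ => hF c]
    _ ≤ r * 1 := by gcongr; exact prob_le_one
    _ = r := mul_one r

namespace DiagIFS

variable {Φ : DiagIFS d A}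

instance : DiscreteMeasurableSpace Φ.Symb := ⟨fun _ => trivial⟩

theorem isProductMeasure_bernoulli {q : Φ.Symb → ℝ} (hq : IsProbVec q) :
    IsProductMeasure Φ (fun _ => q) (bernoulli q) := by
  refine ⟨hq.isProbabilityMeasure_bernoulli, fun n w => ?_⟩
  have e : {ω : ℕ → Φ.Symb | ∀ k < n, ω k = w k} =
      Set.pi (Finset.range n : Set ℕ) fun k => {w k} := by
    ext ω; simp [Set.mem_pi]
  rw [e, hq.bernoulli_pi, ENNReal.toReal_prod]
  refine Finset.prod_congr rfl fun k _ => ?_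
  simp [ENNReal.toReal_ofReal (hq.1 _)]

theorem cyl_eq_pi (m : Fin d → ℕ) (ω : ℕ → Φ.Symb) :
    Φ.cyl m ω = Set.pi (Finset.range (Finset.univ.sup m) : Set ℕ)
      fun k => {b | ∀ i ∈ activeIdx m k, b.1 i = (ω k).1 i} := by
  ext τ
  simp only [cyl, activeIdx, Set.mem_pi, mem_ofPred_eq, Finset.mem_filter, Finset.mem_univ,
    true_and, Finset.coe_range, mem_Iio]
  exact ⟨fun h k _ i hi => h i k hi, fun h i k hk =>
    h k (hk.trans_le (Finset.le_sup (f := m) (Finset.mem_univ i))) i hk⟩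

theorem measurableSet_cyl (m : Fin d → ℕ) (ω : ℕ → Φ.Symb) : MeasurableSet (Φ.cyl m ω) := by
  rw [cyl_eq_pi]
  exact MeasurableSet.pi (Finset.countable_toSet _) fun _ _ => MeasurableSet.of_discrete

theorem bernoulli_cyl {q : Φ.Symb → ℝ} (hq : IsProbVec q) (m : Fin d → ℕ) (ω : ℕ → Φ.Symb) :
    bernoulli q (Φ.cyl m ω) = ENNReal.ofReal (∏ k ∈ Finset.range (Finset.univ.sup m),
      Φ.cylMass (activeIdx m k) q (ω k)) := by
  rw [cyl_eq_pi, hq.bernoulli_pi, ENNReal.ofReal_prod_of_nonneg]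
  · refine Finset.prod_congr rfl fun k _ => ?_
    congr 1
    exact Finset.sum_congr rfl fun b _ => by congr
  · intro k _
    exact Finset.sum_nonneg fun b _ => by split_ifs <;> simp [hq.1 b]

theorem measure_cyl_lt_le {μ ν : Measure (ℕ → Φ.Symb)} [IsProbabilityMeasure ν]
    (m : Fin d → ℕ) (r : ℝ≥0∞) : μ {ω | μ (Φ.cyl m ω) < r * ν (Φ.cyl m ω)} ≤ r := by
  set F : (ℕ → Φ.Symb) → ∀ i, Fin (m i) → A i := fun ω i k => (ω k).1 i with hF
  have hFω : ∀ ω, F ⁻¹' {F ω} = Φ.cyl m ω := by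
    intro ω
    ext τ
    simp only [hF, mem_preimage, mem_singleton_iff, funext_iff, cyl, mem_ofPred_eq]
    exact ⟨fun h i k hk => h i ⟨k, hk⟩, fun h i k => h i k k.2⟩
  have hFm : ∀ c, MeasurableSet (F ⁻¹' {c}) := by
    intro c
    rcases (F ⁻¹' {c}).eq_empty_or_nonempty with he | ⟨ω, hω⟩
    · rw [he]; exact MeasurableSet.empty
    · rw [← show F ω = c from hω, hFω]; exact measurableSet_cyl m ω
  simpa only [hFω] using measure_lt_mul_measure_le (μ := μ) (ν := ν) hFm r

end DiagIFS

theorem le_lowerPtDim_of_measure_ball_le {X : Type*} [PseudoMetricSpace X] [MeasurableSpace X]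
    {μ : Measure X} [IsFiniteMeasure μ] {x : X} {s C : ℝ} (hC : 0 < C)
    (hpos : ∀ r > 0, μ (ball x r) ≠ 0)
    (h : ∀ᶠ r in 𝓝[>] (0 : ℝ), (μ (ball x r)).toReal ≤ C * r ^ s) :
    ENNReal.ofReal s ≤ lowerPtDim μ x := by
  have hlog : Tendsto (fun r : ℝ => s + Real.log C / Real.log r) (𝓝[>] 0) (𝓝 s) := by
    simpa using (Real.tendsto_log_nhdsGT_zero.const_div_atBot (Real.log C)).const_add s
  have hlim := (ENNReal.continuous_ofReal.tendsto s).comp hlog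
  rw [← hlim.liminf_eq]
  refine liminf_le_liminf ?_
  filter_upwards [h, eventually_mem_nhdsWithin,
    eventually_nhdsWithin_of_eventually_nhds (gt_mem_nhds zero_lt_one)] with r hr hr0 hr1
  refine ENNReal.ofReal_le_ofReal ?_
  have hr0 : 0 < r := hr0
  have hlr : Real.log r < 0 := Real.log_neg hr0 hr1
  rw [le_div_iff_of_neg hlr, add_mul, div_mul_cancel₀ _ hlr.ne, ← Real.log_rpow hr0, add_comm,
    ← Real.log_mul hC.ne' (Real.rpow_pos_of_pos hr0 s).ne']
  exact Real.log_le_log (ENNReal.toReal_pos (hpos r hr0) (measure_ne_top _ _)) hr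

theorem le_measDim_of_le {ν ν' : Measure (Fin d → ℝ)} [IsFiniteMeasure ν] (hle : ν' ≤ ν)
    (hne : ν' ≠ 0) {a s b : ℝ} (ha : 0 < a) {N₀ : ℕ}
    (h : ∀ N : ℕ, N₀ ≤ N → ∀ y, ν' (closedBall y (Real.exp (-(a * N)))) ≤
      ENNReal.ofReal (b * Real.exp (-(s * N)))) :
    ENNReal.ofReal (s / a) ≤ measDim ν := by
  rcases le_or_gt s 0 with hs | hs
  · rw [ENNReal.ofReal_of_nonpos (div_nonpos_of_nonpos_of_nonneg hs ha.le)]; exact zero_le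
  have : IsFiniteMeasure ν' := isFiniteMeasure_of_le ν hle
  have := Measure.haveLebesgueDecomposition_of_sigmaFinite ν' ν
  by_contra! hlt
  refine hne ?_
  have hac : ν' ≪ ν := Measure.absolutelyContinuous_of_le hle
  rw [← Measure.withDensity_rnDeriv_eq ν' ν hac, withDensity_eq_zero_iff (by fun_prop)]
  filter_upwards [ae_lt_of_essSup_lt hlt, Besicovitch.ae_tendsto_rnDeriv ν' ν] with x hx hx'
  by_contra! hx0
  refine absurd hx (not_lt.2 ?_)
  obtain ⟨ℓ, hℓ0, hℓ⟩ := exists_between (pos_iff_ne_zero.2 hx0)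
  have hℓt : ℓ ≠ ⊤ := ne_top_of_lt hℓ
  have hev := hx'.eventually (lt_mem_nhds hℓ)
  have hpos : ∀ r > 0, ν (ball x r) ≠ 0 := by
    intro r hr
    obtain ⟨t, ht, htr, ht0⟩ := (hev.and ((eventually_nhdsWithin_of_eventually_nhds
      (gt_mem_nhds hr)).and eventually_mem_nhdsWithin)).exists
    intro h0
    have h1 : ν' (closedBall x t) = 0 :=
      hac (measure_mono_null (closedBall_subset_ball htr) h0)
    simp [h1] at ht
  have hℓr : 0 < ℓ.toReal := ENNReal.toReal_pos hℓ0.ne' hℓt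
  refine le_lowerPtDim_of_measure_ball_le (C := |b| * Real.exp s / ℓ.toReal + 1) (by positivity)
    hpos ?_
  have hsmall : ∀ᶠ r in 𝓝[>] (0 : ℝ), (N₀ : ℝ) + 1 ≤ -Real.log r / a :=
    ((tendsto_neg_atBot_atTop.comp Real.tendsto_log_nhdsGT_zero).atTop_div_const
      ha).eventually_ge_atTop _
  filter_upwards [hev, hsmall, eventually_mem_nhdsWithin] with r hr hrN hr0
  have hr0 : 0 < r := hr0
  set N := ⌊-Real.log r / a⌋₊ with hN
  have hN1 : (N : ℝ) ≤ -Real.log r / a := Nat.floor_le (by linarith [(N₀.cast_nonneg : (0:ℝ) ≤ N₀)])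
  have hN2 : -Real.log r / a < N + 1 := Nat.lt_floor_add_one _
  have hN3 : N₀ ≤ N := Nat.le_floor (by linarith)
  rw [le_div_iff₀ ha] at hN1
  have hrexp : r ≤ Real.exp (-(a * N)) := by
    rw [← Real.log_le_iff_le_exp hr0]; linarith
  have h1 : ℓ * ν (closedBall x r) ≤ ENNReal.ofReal (b * Real.exp (-(s * N))) :=
    (ENNReal.mul_le_of_le_div hr.le).trans
      ((measure_mono (closedBall_subset_closedBall hrexp)).trans (h N hN3 x))
  have h2 := ENNReal.toReal_mono ENNReal.ofReal_ne_top h1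
  rw [ENNReal.toReal_mul, ENNReal.toReal_ofReal'] at h2
  have h3 : max (b * Real.exp (-(s * N))) 0 ≤ |b| * (Real.exp s * r ^ (s / a)) := by
    have h4 : Real.exp (-(s * N)) ≤ Real.exp s * r ^ (s / a) := by
      rw [Real.rpow_def_of_pos hr0, ← Real.exp_add, Real.exp_le_exp]
      have := mul_lt_mul_of_pos_left hN2 hs
      have e : s * (-Real.log r / a) = -(Real.log r * (s / a)) := by ring
      linarith
    refine max_le ((mul_le_mul_of_nonneg_right (le_abs_self b) (Real.exp_pos _).le).trans
      (mul_le_mul_of_nonneg_left h4 (abs_nonneg b))) (by positivity)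
  have h5 : (ν (ball x r)).toReal ≤ (ν (closedBall x r)).toReal :=
    ENNReal.toReal_mono (measure_ne_top _ _) (measure_mono ball_subset_closedBall)
  refine h5.trans ?_
  have h6 : (ν (closedBall x r)).toReal ≤ |b| * Real.exp s / ℓ.toReal * r ^ (s / a) := by
    rw [div_mul_eq_mul_div, le_div_iff₀ hℓr]
    linarith
  have h7 : 0 ≤ r ^ (s / a) := by positivity
  linarith

namespace DiagIFS

/-- the time at which the `i`-th side of a `q`-typical cylinder has length about `e^{-N}` -/
noncomputable def stopTime (Φ : DiagIFS d A) (q : Φ.Symb → ℝ) (N : ℕ) (i : Fin d) : ℕ :=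
  ⌈(N : ℝ) / Φ.chi i q⌉₊

/-- the largest of the times `stopTime` -/
noncomputable def maxStopTime (Φ : DiagIFS d A) (q : Φ.Symb → ℝ) (N : ℕ) : ℕ :=
  Finset.univ.sup (Φ.stopTime q N)

/-- the cross entropy `-∫ log q([a]_I) dp(a)` -/
noncomputable def crossEntropy (Φ : DiagIFS d A) (I : Finset (Fin d)) (p q : Φ.Symb → ℝ) : ℝ :=
  ∑ a : Φ.Symb, p a * -Real.log (Φ.cylMass I q a)

/-- the entropy of `bernoulli q` with respect to the partition into approximate cubes of
size about `e^{-N}` -/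
noncomputable def cubeEntropy (Φ : DiagIFS d A) (q : Φ.Symb → ℝ) (N : ℕ) : ℝ :=
  ∑ k ∈ Finset.range (Φ.maxStopTime q N), Φ.entropy (activeIdx (Φ.stopTime q N) k) q

variable {Φ : DiagIFS d A} {p q : Φ.Symb → ℝ} {ω : ℕ → Φ.Symb}

theorem crossEntropy_self (I : Finset (Fin d)) : Φ.crossEntropy I q q = Φ.entropy I q := by
  simp [crossEntropy, entropy]

theorem chi_eq_sum (i : Fin d) : Φ.chi i p = ∑ a : Φ.Symb, p a * -Real.log |Φ.slope i (a.1 i)| := by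
  simp [chi]

theorem le_chi (hp : IsProbVec p) {κ : ℝ} (hκ : ∀ i a, κ ≤ -Real.log |Φ.slope i a|) (i : Fin d) :
    κ ≤ Φ.chi i p := by
  rw [chi_eq_sum]
  calc κ = ∑ a, p a * κ := by rw [← Finset.sum_mul, hp.2, one_mul]
    _ ≤ _ := Finset.sum_le_sum fun a _ => mul_le_mul_of_nonneg_left (hκ i _) (hp.1 a)

theorem Valid.chi_pos (hV : Φ.Valid) (hp : IsProbVec p) (i : Fin d) : 0 < Φ.chi i p := by
  obtain ⟨κ, hκ0, hκ⟩ := hV.exists_le_neg_log_slope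
  exact hκ0.trans_le (le_chi hp hκ i)

theorem Valid.exists_stopTime_le (hV : Φ.Valid) : ∃ C : ℝ, 0 < C ∧ ∀ q : Φ.Symb → ℝ, IsProbVec q →
    ∀ᶠ N : ℕ in atTop, (∀ i, (Φ.stopTime q N i : ℝ) ≤ C * N) ∧ (Φ.maxStopTime q N : ℝ) ≤ C * N := by
  obtain ⟨κ, hκ0, hκ⟩ := hV.exists_le_neg_log_slope
  refine ⟨κ⁻¹ + 1, by positivity, fun q hq => ?_⟩
  filter_upwards [eventually_ge_atTop 1] with N hN
  have hN : (1 : ℝ) ≤ N := by exact_mod_cast hN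
  have h : ∀ i, (Φ.stopTime q N i : ℝ) ≤ (κ⁻¹ + 1) * N := by
    intro i
    have h1 := (Nat.ceil_lt_add_one (div_nonneg N.cast_nonneg (hV.chi_pos hq i).le)).le
    have h2 : (N : ℝ) / Φ.chi i q ≤ N / κ := by gcongr; exact le_chi hq hκ i
    rw [stopTime]
    rw [div_eq_mul_inv (N : ℝ) κ] at h2
    linarith
  refine ⟨h, ?_⟩
  have : Φ.maxStopTime q N ≤ ⌊(κ⁻¹ + 1) * N⌋₊ := Finset.sup_le fun i _ => Nat.le_floor (h i)
  exact (Nat.cast_le.2 this).trans (Nat.floor_le (by positivity))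

theorem Valid.neg_log_wordSlope (hV : Φ.Valid) (i : Fin d) (n : ℕ) :
    -Real.log |Φ.wordSlope i n (Φ.coordSeq ω i)| =
      ∑ k ∈ Finset.range n, -Real.log |Φ.slope i ((ω k).1 i)| := by
  rw [wordSlope, Finset.abs_prod, Real.log_prod fun k _ => abs_ne_zero.2 (hV.2.1 _ _),
    Finset.sum_neg_distrib]
  rfl

theorem Valid.eventually_abs_log_wordSlope_sub_le (hV : Φ.Valid) (hω : HasFreq ω p)
    (hq : IsProbVec q) {ε : ℝ} (hε : 0 < ε) : ∀ᶠ N : ℕ in atTop, ∀ i,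
      |-Real.log |Φ.wordSlope i (Φ.stopTime q N i) (Φ.coordSeq ω i)| -
        Φ.stopTime q N i * Φ.chi i p| ≤ ε * N := by
  obtain ⟨C, hC, h⟩ := hV.exists_stopTime_le
  have h1 : ∀ᶠ N : ℕ in atTop, ∀ i, ∀ n : ℕ, (n : ℝ) ≤ C * N →
      |∑ k ∈ Finset.range n, (-Real.log |Φ.slope i ((ω k).1 i)| - ∑ a, p a *
        -Real.log |Φ.slope i (a.1 i)|)| ≤ ε * N := eventually_all.2 fun i =>
    hω.eventually_abs_sum_sub_le (fun a => -Real.log |Φ.slope i (a.1 i)|) hC.le hε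
  filter_upwards [h1, h q hq] with N hN hN' i
  have := hN i _ (hN'.1 i)
  rwa [Finset.sum_sub_distrib, Finset.sum_const, Finset.card_range, nsmul_eq_mul, ← chi_eq_sum,
    ← hV.neg_log_wordSlope] at this

theorem cylMass_pos (hpos : ∀ a, 0 < q a) (I : Finset (Fin d)) (a : Φ.Symb) :
    0 < Φ.cylMass I q a :=
  Finset.sum_pos' (fun b _ => by split_ifs <;> simp [(hpos b).le])
    ⟨a, Finset.mem_univ a, by simpa using hpos a⟩

theorem cylMass_le_one (hq : IsProbVec q) (I : Finset (Fin d)) (a : Φ.Symb) :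
    Φ.cylMass I q a ≤ 1 := by
  rw [← hq.2]
  exact Finset.sum_le_sum fun b _ => by split_ifs <;> simp [hq.1 b]

theorem Valid.eventually_abs_log_bernoulli_cyl_sub_le (hV : Φ.Valid) (hω : HasFreq ω p)
    (hq : IsProbVec q) (hpos : ∀ a, 0 < q a) {ε : ℝ} (hε : 0 < ε) : ∀ᶠ N : ℕ in atTop,
    ∃ t : ℝ, bernoulli q (Φ.cyl (Φ.stopTime q N) ω) = ENNReal.ofReal (Real.exp (-t)) ∧
      |t - ∑ k ∈ Finset.range (Φ.maxStopTime q N),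
        Φ.crossEntropy (activeIdx (Φ.stopTime q N) k) p q| ≤ ε * N := by
  obtain ⟨C, hC, h⟩ := hV.exists_stopTime_le
  filter_upwards [hω.eventually_abs_sum_activeIdx_le
    (fun I a => -Real.log (Φ.cylMass I q a)) (Φ.stopTime q) (Φ.maxStopTime q) hC.le hε
    ((h q hq).mono fun N hN => hN.2)] with N hN
  refine ⟨_, ?_, by rwa [Finset.sum_sub_distrib] at hN⟩
  rw [bernoulli_cyl hq, Finset.sum_neg_distrib, neg_neg, Real.exp_sum]
  congr 1
  exact Finset.prod_congr rfl fun k _ => (Real.exp_log (cylMass_pos hpos _ _)).symm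

theorem Baranski.le_measDim_bernoulli (hB : Φ.Baranski) (hV : Φ.Valid) (hq : IsProbVec q)
    (hpos : ∀ a, 0 < q a) {c : ℝ} (hc : ∀ᶠ N : ℕ in atTop, c * N ≤ Φ.cubeEntropy q N) :
    ENNReal.ofReal c ≤ measDim (Measure.map Φ.coding (bernoulli q)) := by
  have := hq.isProbabilityMeasure_bernoulli
  have hlim : Tendsto (fun ε : ℝ => ENNReal.ofReal ((c - ε) / (1 + 2 * ε))) (𝓝[>] 0)
      (𝓝 (ENNReal.ofReal c)) := by
    refine (ENNReal.continuous_ofReal.tendsto c).comp (tendsto_nhdsWithin_of_tendsto_nhds ?_)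
    have : ContinuousAt (fun ε : ℝ => (c - ε) / (1 + 2 * ε)) 0 :=
      ContinuousAt.div (by fun_prop) (by fun_prop) (by norm_num)
    simpa [ContinuousAt] using this
  refine le_of_tendsto hlim ?_
  filter_upwards [eventually_mem_nhdsWithin] with ε hε
  have hε : 0 < ε := hε
  set T : ℕ → Set (ℕ → Φ.Symb) := fun N₀ => {ω | ∀ N, N₀ ≤ N →
    (∀ i, Real.exp (-((1 + 2 * ε) * N)) ≤ |Φ.wordSlope i (Φ.stopTime q N i) (Φ.coordSeq ω i)|) ∧
      bernoulli q (Φ.cyl (Φ.stopTime q N) ω) ≤ ENNReal.ofReal (Real.exp (-((c - ε) * N)))} with hT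
  have hae : ∀ᵐ ω ∂(bernoulli q), ω ∈ ⋃ N₀, T N₀ := by
    filter_upwards [hq.ae_hasFreq_bernoulli] with ω hω
    have hchi : ∀ᶠ N : ℕ in atTop, ∀ i, Φ.chi i q ≤ ε * N := eventually_all.2 fun i =>
      (tendsto_natCast_atTop_atTop.const_mul_atTop hε).eventually_ge_atTop _
    obtain ⟨N₀, hN₀⟩ := eventually_atTop.1 ((hV.eventually_abs_log_wordSlope_sub_le hω hq hε).and
      ((hV.eventually_abs_log_bernoulli_cyl_sub_le hω hq hpos hε).and (hchi.and hc)))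
    refine mem_iUnion.2 ⟨N₀, fun N hN => ?_⟩
    obtain ⟨h1, ⟨t, ht, ht'⟩, h3, h4⟩ := hN₀ N hN
    refine ⟨fun i => ?_, ?_⟩
    · have h5 := (abs_le.1 (h1 i)).2
      have hx := hV.chi_pos hq i
      have h6 : (Φ.stopTime q N i : ℝ) * Φ.chi i q ≤ N + Φ.chi i q := by
        have := mul_le_mul_of_nonneg_right
          (Nat.ceil_lt_add_one (div_nonneg N.cast_nonneg hx.le)).le hx.le
        rwa [add_mul, div_mul_cancel₀ _ hx.ne', one_mul] at this
      have hs : 0 < |Φ.wordSlope i (Φ.stopTime q N i) (Φ.coordSeq ω i)| :=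
        abs_pos.2 (Finset.prod_ne_zero_iff.2 fun k _ => hV.2.1 _ _)
      rw [← Real.le_log_iff_exp_le hs]
      linarith [h3 i]
    · rw [ht]
      refine ENNReal.ofReal_le_ofReal (Real.exp_le_exp.2 ?_)
      simp_rw [crossEntropy_self] at ht'
      have := (abs_le.1 ht').1
      rw [cubeEntropy] at h4
      linarith
  obtain ⟨N₀, hN₀⟩ : ∃ N₀, bernoulli q (T N₀) ≠ 0 := by
    by_contra! h0
    have h1 : ∀ᵐ ω ∂(bernoulli q), ω ∉ ⋃ N₀, T N₀ := measure_eq_zero_iff_ae_notMem.1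
      (measure_iUnion_null h0)
    obtain ⟨ω, h2, h3⟩ := (hae.and h1).exists
    exact h3 h2
  have hcm := hV.measurable_coding
  refine le_measDim_of_le (ν' := Measure.map Φ.coding ((bernoulli q).restrict (T N₀)))
    (b := 9 ^ d) (N₀ := N₀) (Measure.map_mono Measure.restrict_le_self hcm) ?_ (by positivity) ?_
  · rw [Ne, Measure.map_eq_zero_iff hcm.aemeasurable, Measure.restrict_eq_zero]
    exact hN₀
  · intro N hN y
    rw [Measure.map_apply hcm measurableSet_closedBall,
      Measure.restrict_apply (hcm measurableSet_closedBall), inter_comm]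
    have h1 := hB.measure_inter_le hV (Real.exp_pos (-((1 + 2 * ε) * N)))
      (fun ω hω => (hω N hN).1) (fun ω hω => (hω N hN).2) y (T := T N₀)
    refine le_trans (measure_mono ?_) (h1.trans (le_of_eq ?_))
    · refine inter_subset_inter_right _ fun ω hω i => ?_
      have h2 := (dist_pi_le_iff (Real.exp_pos _).le).1 (mem_closedBall.1 hω) i
      rwa [Real.dist_eq] at h2
    · rw [ENNReal.ofReal_mul (by positivity), ENNReal.ofReal_pow (by norm_num)]
      norm_num

end DiagIFS

theorem lowerPtDim_le_of_frequently {X : Type*} [PseudoMetricSpace X] [MeasurableSpace X]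
    {μ : Measure X} [IsFiniteMeasure μ] {x : X} {a s : ℝ} (ha : 0 < a)
    (h : ∃ᶠ N : ℕ in atTop, ENNReal.ofReal (Real.exp (-(s * N))) ≤
      μ (ball x (Real.exp (-(a * N))))) :
    lowerPtDim μ x ≤ ENNReal.ofReal (s / a) := by
  have hlim : Tendsto (fun N : ℕ => Real.exp (-(a * N))) atTop (𝓝[>] 0) :=
    tendsto_nhdsWithin_iff.2 ⟨Real.tendsto_exp_neg_atTop_nhds_zero.comp
      (tendsto_natCast_atTop_atTop.const_mul_atTop ha),
      Eventually.of_forall fun N => Real.exp_pos _⟩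
  refine liminf_le_of_frequently_le (hlim.frequently ?_)
  refine (h.and_eventually (eventually_gt_atTop 0)).mono fun N hN => ENNReal.ofReal_le_ofReal ?_
  obtain ⟨hN, hN0⟩ := hN
  have hN0 : (0 : ℝ) < N := by exact_mod_cast hN0
  have h1 := ENNReal.toReal_mono (measure_ne_top _ _) hN
  rw [ENNReal.toReal_ofReal (Real.exp_pos _).le] at h1
  have h2 := (Real.le_log_iff_exp_le ((Real.exp_pos _).trans_le h1)).2 h1
  rw [Real.log_exp, div_le_iff_of_neg (by nlinarith)]
  refine le_trans (le_of_eq ?_) h2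
  field_simp

theorem measurable_measure_ball {X : Type*} [PseudoMetricSpace X] [SecondCountableTopology X]
    [MeasurableSpace X] [OpensMeasurableSpace X] (μ : Measure X) [SFinite μ] (r : ℝ) :
    Measurable fun x => μ (ball x r) := by
  have : MeasurableSet {z : X × X | dist z.2 z.1 < r} :=
    measurableSet_lt (measurable_snd.dist measurable_fst) measurable_const
  exact measurable_measure_prodMk_left this

namespace DiagIFS

variable {Φ : DiagIFS d A} {p q : Φ.Symb → ℝ} {ω : ℕ → Φ.Symb}

theorem neg_log_cylMass_nonneg (hq : IsProbVec q) (I : Finset (Fin d)) (a : Φ.Symb) :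
    0 ≤ -Real.log (Φ.cylMass I q a) :=
  neg_nonneg.2 (Real.log_nonpos
    (Finset.sum_nonneg fun b _ => by split_ifs <;> simp [hq.1 b]) (cylMass_le_one hq I a))

theorem continuous_chi (i : Fin d) : Continuous (Φ.chi i) := by
  unfold chi
  fun_prop

theorem continuous_crossEntropy (I : Finset (Fin d)) (q : Φ.Symb → ℝ) :
    Continuous fun p => Φ.crossEntropy I p q := by
  unfold crossEntropy
  fun_prop

/-- `q` is a good substitute for `p` when estimating masses of cylinders -/
def Dominates (Φ : DiagIFS d A) (ε : ℝ) (q p : Φ.Symb → ℝ) : Prop :=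
  (∀ i, (1 - ε) * Φ.chi i q ≤ Φ.chi i p) ∧
    ∀ I, Φ.crossEntropy I p q ≤ (1 + ε) * Φ.entropy I q + ε

theorem Valid.exists_dominates (hV : Φ.Valid) (hp : IsProbVec p) {ε : ℝ} (hε : 0 < ε) :
    ∃ q, IsProbVec q ∧ (∀ a, 0 < q a) ∧ ∀ᶠ p' in 𝓝 p, Φ.Dominates ε q p' := by
  have hne : Nonempty Φ.Symb := hV.1.to_subtype
  set u : ℝ := (Fintype.card Φ.Symb : ℝ)⁻¹ with hu
  have hu0 : 0 < u := by
    have : (0 : ℝ) < Fintype.card Φ.Symb := by exact_mod_cast Fintype.card_pos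
    positivity
  set Q : ℝ → Φ.Symb → ℝ := fun t a => (1 - t) * p a + t * u with hQ
  have hQc : Continuous Q := by fun_prop
  have hQ0 : Q 0 = p := by ext a; simp [hQ]
  have hchi : ∀ᶠ t in 𝓝 (0 : ℝ), ∀ i, (1 - ε) * Φ.chi i (Q t) < Φ.chi i p := by
    refine eventually_all.2 fun i => ?_
    have : Continuous fun t => (1 - ε) * Φ.chi i (Q t) :=
      ((continuous_chi i).comp hQc).const_mul _
    refine this.continuousAt.eventually_lt continuousAt_const ?_
    rw [hQ0]
    nlinarith [hV.chi_pos hp i]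
  have hε' : ∀ᶠ t in 𝓝 (0 : ℝ), 1 < (1 + ε) * (1 - t) := by
    have : Continuous fun t : ℝ => (1 + ε) * (1 - t) := by fun_prop
    exact continuousAt_const.eventually_lt this.continuousAt (by simpa using hε)
  obtain ⟨t, ⟨h1, h2, h3⟩, ht0⟩ := ((eventually_nhdsWithin_of_eventually_nhds
    (hchi.and (hε'.and (gt_mem_nhds zero_lt_one)))).and
      (eventually_mem_nhdsWithin (a := (0 : ℝ)) (s := Ioi 0))).exists
  have ht0 : 0 < t := ht0
  have hQpos : ∀ a, 0 < Q t a := fun a =>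
    add_pos_of_nonneg_of_pos (mul_nonneg (by linarith) (hp.1 a)) (by positivity)
  have hQp : IsProbVec (Q t) := by
    refine ⟨fun a => (hQpos a).le, ?_⟩
    simp only [hQ]
    rw [Finset.sum_add_distrib, ← Finset.mul_sum, hp.2, Finset.sum_const, Finset.card_univ,
      nsmul_eq_mul, hu]
    field_simp
    ring
  refine ⟨Q t, hQp, hQpos, ?_⟩
  have h4 : ∀ I, Φ.crossEntropy I p (Q t) < (1 + ε) * Φ.entropy I (Q t) + ε := by
    intro I
    refine lt_of_le_of_lt ?_ (lt_add_of_pos_right _ hε)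
    rw [← crossEntropy_self, crossEntropy, crossEntropy, Finset.mul_sum]
    refine Finset.sum_le_sum fun a _ => ?_
    rw [← mul_assoc]
    refine mul_le_mul_of_nonneg_right ?_ (neg_log_cylMass_nonneg hQp I a)
    simp only [hQ]
    have h5 : 0 ≤ ((1 + ε) * (1 - t) - 1) * p a := mul_nonneg (by linarith) (hp.1 a)
    have h6 : 0 ≤ (1 + ε) * (t * u) := by positivity
    linarith
  exact (eventually_all.2 fun i => ((continuous_chi i).continuousAt.eventually
    (lt_mem_nhds (h1 i))).mono fun _ => le_of_lt).and (eventually_all.2 fun I =>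
      ((continuous_crossEntropy I (Q t)).continuousAt.eventually
        (gt_mem_nhds (h4 I))).mono fun _ => le_of_lt)

theorem ae_eventually_le_measure_cyl {μ : Measure (ℕ → Φ.Symb)} (hq : IsProbVec q)
    (m : ℕ → Fin d → ℕ) {ε : ℝ} (hε : 0 < ε) : ∀ᵐ ω ∂μ, ∀ᶠ N : ℕ in atTop,
      ENNReal.ofReal (Real.exp (-(ε * N))) * bernoulli q (Φ.cyl (m N) ω) ≤ μ (Φ.cyl (m N) ω) := by
  have := hq.isProbabilityMeasure_bernoulli
  have hsum : Summable fun N : ℕ => Real.exp (-(ε * N)) := by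
    have := Real.summable_exp_nat_mul_iff.2 (neg_neg_of_pos hε)
    refine this.congr fun N => ?_
    congr 1; ring
  have hfin : ∑' N : ℕ, μ {ω | μ (Φ.cyl (m N) ω) <
      ENNReal.ofReal (Real.exp (-(ε * N))) * bernoulli q (Φ.cyl (m N) ω)} ≠ ⊤ :=
    ne_top_of_le_ne_top hsum.tsum_ofReal_ne_top
      (ENNReal.tsum_le_tsum fun N => measure_cyl_lt_le (m N) _)
  filter_upwards [ae_eventually_notMem hfin] with ω hω
  exact hω.mono fun N hN => not_lt.1 hN

theorem Valid.ae_frequently_le_measure_ball (hV : Φ.Valid) {μ : Measure (ℕ → Φ.Symb)}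
    (hq : IsProbVec q) (hpos : ∀ a, 0 < q a) {c C ε : ℝ} (hε : 0 < ε) (hε1 : ε ≤ 1)
    (hC : ∀ᶠ N : ℕ in atTop, (Φ.maxStopTime q N : ℝ) ≤ C * N)
    (hc : ∃ᶠ N : ℕ in atTop, Φ.cubeEntropy q N ≤ c * N) :
    ∀ᵐ ω ∂μ, ∀ p, HasFreq ω p → Φ.Dominates ε q p → ∃ᶠ N : ℕ in atTop,
      ENNReal.ofReal (Real.exp (-(((1 + ε) * c + ε * (C + 2)) * N))) ≤
        Measure.map Φ.coding μ (ball (Φ.coding ω) (Real.exp (-((1 - 3 * ε) * N)))) := by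
  filter_upwards [ae_eventually_le_measure_cyl (μ := μ) hq (Φ.stopTime q) hε] with ω hω p hp hdom
  refine (hc.and_eventually (hω.and ((hV.eventually_abs_log_wordSlope_sub_le hp hq hε).and
    ((hV.eventually_abs_log_bernoulli_cyl_sub_le hp hq hpos hε).and
      (hC.and (eventually_gt_atTop 0)))))).mono ?_
  rintro N ⟨h1, h2, h3, ⟨t, ht, ht'⟩, h5, h6⟩
  have h6 : (0 : ℝ) < N := by exact_mod_cast h6
  rw [Measure.map_apply hV.measurable_coding measurableSet_ball]
  refine le_trans ?_ (h2.trans (measure_mono fun τ hτ => ?_))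
  · rw [ht, ← ENNReal.ofReal_mul (Real.exp_pos _).le, ← Real.exp_add]
    refine ENNReal.ofReal_le_ofReal (Real.exp_le_exp.2 ?_)
    have h7 : ∑ k ∈ Finset.range (Φ.maxStopTime q N),
        Φ.crossEntropy (activeIdx (Φ.stopTime q N) k) p q ≤
          (1 + ε) * Φ.cubeEntropy q N + Φ.maxStopTime q N * ε := by
      refine (Finset.sum_le_sum fun k _ => hdom.2 (activeIdx (Φ.stopTime q N) k)).trans
        (le_of_eq ?_)
      rw [Finset.sum_add_distrib, ← Finset.mul_sum, Finset.sum_const, Finset.card_range,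
        nsmul_eq_mul, cubeEntropy]
    have h8 := (abs_le.1 ht').2
    nlinarith
  · refine mem_ball.2 ((dist_pi_lt_iff (Real.exp_pos _)).2 fun i => ?_)
    rw [Real.dist_eq]
    refine (hV.abs_coding_sub_le hτ i).trans_lt ?_
    have hs : 0 < |Φ.wordSlope i (Φ.stopTime q N i) (Φ.coordSeq ω i)| :=
      abs_pos.2 (Finset.prod_ne_zero_iff.2 fun k _ => hV.2.1 _ _)
    rw [← Real.log_lt_iff_lt_exp hs]
    have h7 := (abs_le.1 (h3 i)).1
    have hx := hV.chi_pos hq i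
    have h8 : (N : ℝ) ≤ Φ.stopTime q N i * Φ.chi i q := by
      rw [← div_le_iff₀ hx]; exact Nat.le_ceil _
    have h9 := mul_le_mul_of_nonneg_left (hdom.1 i) (Φ.stopTime q N i).cast_nonneg (α := ℝ)
    have h10 := mul_le_mul_of_nonneg_left h8 (sub_nonneg.2 hε1)
    nlinarith [mul_pos hε h6]

theorem Valid.measDim_le (hV : Φ.Valid) {μ : Measure (ℕ → Φ.Symb)} [IsProbabilityMeasure μ]
    (hμ : Measure.map shift μ = μ) {c : ℝ} (hc : ∀ q, IsProbVec q → (∀ a, 0 < q a) →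
      ∃ᶠ N : ℕ in atTop, Φ.cubeEntropy q N ≤ c * N) :
    measDim (Measure.map Φ.coding μ) ≤ ENNReal.ofReal c := by
  obtain ⟨C, -, hC⟩ := hV.exists_stopTime_le
  have hcm := hV.measurable_coding
  have := Measure.isProbabilityMeasure_map (μ := μ) hcm.aemeasurable
  have hlim : Tendsto (fun ε : ℝ => ENNReal.ofReal (((1 + ε) * c + ε * (C + 2)) / (1 - 3 * ε)))
      (𝓝[>] 0) (𝓝 (ENNReal.ofReal c)) := by
    refine (ENNReal.continuous_ofReal.tendsto c).comp (tendsto_nhdsWithin_of_tendsto_nhds ?_)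
    have : ContinuousAt (fun ε : ℝ => ((1 + ε) * c + ε * (C + 2)) / (1 - 3 * ε)) 0 :=
      ContinuousAt.div (by fun_prop) (by fun_prop) (by norm_num)
    simpa [ContinuousAt] using this
  refine ge_of_tendsto hlim ?_
  filter_upwards [eventually_mem_nhdsWithin, eventually_nhdsWithin_of_eventually_nhds
    (gt_mem_nhds (show (0 : ℝ) < 1 / 3 by norm_num))] with ε hε hε'
  have hε : 0 < ε := hε
  choose! Q hQ hQpos hQdom using fun p (hp : IsProbVec p) => hV.exists_dominates hp hε
  obtain ⟨t, hts, htc, ht⟩ := TopologicalSpace.countable_cover_nhdsWithin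
    (s := {p : Φ.Symb → ℝ | IsProbVec p}) (f := fun p => {p' | Φ.Dominates ε (Q p) p'})
    fun p hp => mem_nhdsWithin_of_mem_nhds (hQdom p hp)
  have hae := (ae_ball_iff htc).2 fun p hp => hV.ae_frequently_le_measure_ball (μ := μ)
    (hQ p (hts hp)) (hQpos p (hts hp)) hε (by linarith)
    ((hC _ (hQ p (hts hp))).mono fun N hN => hN.2)
    (hc _ (hQ p (hts hp)) (hQpos p (hts hp)))
  refine essSup_le_of_ae_le _ ?_
  have hG : ∀ᵐ x ∂(Measure.map Φ.coding μ), ∃ᶠ N : ℕ in atTop,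
      ENNReal.ofReal (Real.exp (-(((1 + ε) * c + ε * (C + 2)) * N))) ≤
        Measure.map Φ.coding μ (ball x (Real.exp (-((1 - 3 * ε) * N)))) := by
    rw [ae_map_iff hcm.aemeasurable]
    · filter_upwards [hae, ae_exists_hasFreq hμ] with ω hω hp
      obtain ⟨p, hp⟩ := hp
      obtain ⟨p', hp', hpp'⟩ := mem_iUnion₂.1 (ht hp.isProbVec)
      exact hω p' hp' p hp hpp'
    · have := MeasurableSet.measurableSet_limsup fun N : ℕ => measurableSet_le
        (measurable_const (a := ENNReal.ofReal (Real.exp (-(((1 + ε) * c + ε * (C + 2)) * N)))))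
        (measurable_measure_ball (Measure.map Φ.coding μ) (Real.exp (-((1 - 3 * ε) * N))))
      convert this using 1
      ext x
      rw [mem_limsup_iff_frequently_mem]
      rfl
  filter_upwards [hG] with x hx using lowerPtDim_le_of_frequently (by linarith) hx

end DiagIFS

/-- The dynamical dimension of a Barański sponge equals the supremum of the
Hausdorff dimensions of its Bernoulli measures. -/
theorem dynDim_eq_sup_bernoulliDims {d : ℕ} {A : Fin d → Type} [∀ i, Fintype (A i)]
    (Φ : DiagIFS d A) (hV : Φ.Valid) (hB : Φ.Baranski) :
    Φ.dynDim = sSup (bernoulliDims Φ) := by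
  refine le_antisymm (sSup_le ?_) (sSup_le ?_)
  · rintro _ ⟨μ, hμ, hμs, rfl⟩
    by_contra! hlt
    obtain ⟨r, hr1, hr2⟩ := ENNReal.lt_iff_exists_nnreal_btwn.1 hlt
    refine absurd hr2 (not_lt.2 ?_)
    rw [← ENNReal.ofReal_coe_nnreal] at hr1 ⊢
    refine hV.measDim_le hμs fun q hq hpos => ?_
    by_contra! hev
    refine absurd hr1 (not_lt.2 ?_)
    refine (hB.le_measDim_bernoulli hV hq hpos
      (hev.mono fun N hN => le_of_lt hN)).trans ?_
    exact le_sSup ⟨q, hq, _, DiagIFS.isProductMeasure_bernoulli hq, rfl⟩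
  · rintro _ ⟨p, hp, μ, ⟨hμ, hμp⟩, rfl⟩
    exact le_sSup ⟨μ, hμ, map_shift_eq_of_prefixCyl hp hμp, rfl⟩

end SelfAffineSponge
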